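/- Let G = ⟨a_1,…,a_k | R⟩ be a C'(λ)-presentation with λ ≤ 1/100 and suppose every r ∈ R has |r| ≥ 2/λ + 1. If w is a cyclically reduced word in F(A) that is conjugate in G to a_1, then either w = a_1 in F(A) or w is not cyclically λ-reduced with respect to R. -/

import Mathlib

/-!
STATEMENT 6: in a C'(λ)-presentation G = ⟨a₁,…,a_k | R⟩ with λ ≤ 1/100 and
|r| ≥ 2/λ + 1 for all r ∈ R: if w is a cyclically reduced word conjugate in G
to a₁, then w = a₁ in F(A) or w is not cyclically λ-reduced w.r.t. R.
-/

/-- The formal inverse of a word: reverse the word and invert each letter. -/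
def wordInv {α : Type} (l : List (α × Bool)) : List (α × Bool) :=
  (l.map fun p => (p.1, !p.2)).reverse

/-- `u` is a (contiguous) subword of `w`. -/
def Subword {α : Type} (u w : List (α × Bool)) : Prop :=
  ∃ s t : List (α × Bool), w = s ++ u ++ t

/-- `g` is cyclically reduced: in its reduced word the first letter is not
the inverse of the last letter. -/
def CyclicallyReduced {α : Type} [DecidableEq α] (g : FreeGroup α) : Prop :=
  ∀ x y : α × Bool, g.toWord.head? = some x → g.toWord.getLast? = some y →
    x ≠ (y.1, !y.2)

/-- `R` is a symmetrized set of cyclically reduced words: it is closed under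
inversion and under all cyclic permutations. -/
def Symmetrized {α : Type} [DecidableEq α] (R : Set (FreeGroup α)) : Prop :=
  (∀ r ∈ R, CyclicallyReduced r) ∧
  (∀ r ∈ R, ∀ n : ℕ, FreeGroup.mk (r.toWord.rotate n) ∈ R) ∧
  (∀ r ∈ R, r⁻¹ ∈ R)

/-- `v` is a piece with respect to `R`: an initial segment of two distinct
elements of `R`. -/
def IsPiece {α : Type} [DecidableEq α] (R : Set (FreeGroup α)) (v : List (α × Bool)) : Prop :=
  ∃ r₁ ∈ R, ∃ r₂ ∈ R, r₁ ≠ r₂ ∧ v <+: r₁.toWord ∧ v <+: r₂.toWord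

/-- `R` is a symmetrized `C'(λ)` small cancellation set: whenever a piece `v`
with respect to `R` is a subword of some `r ∈ R`, then `|v| < λ|r|`. -/
def CPrime {α : Type} [DecidableEq α] (lam : ℝ) (R : Set (FreeGroup α)) : Prop :=
  Symmetrized R ∧
    ∀ v, IsPiece R v → ∀ r ∈ R, Subword v r.toWord →
      (v.length : ℝ) < lam * (r.toWord.length : ℝ)

/-- A word `l` is λ-reduced with respect to `R`: it contains no subword `u`
that is also a subword of some `r ∈ R` with `|u| > (1-3λ)|r|`. -/
def LambdaReduced {α : Type} [DecidableEq α] (lam : ℝ) (R : Set (FreeGroup α))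
    (l : List (α × Bool)) : Prop :=
  ∀ u, Subword u l → ∀ r ∈ R, Subword u r.toWord →
    (u.length : ℝ) ≤ (1 - 3 * lam) * (r.toWord.length : ℝ)

/-- A cyclically reduced word is cyclically λ-reduced with respect to `R` if
every cyclic permutation of it is λ-reduced with respect to `R`. -/
def CyclLambdaReduced {α : Type} [DecidableEq α] (lam : ℝ) (R : Set (FreeGroup α))
    (l : List (α × Bool)) : Prop :=
  ∀ n : ℕ, LambdaReduced lam R (l.rotate n)


set_option linter.unusedSectionVars false
set_option linter.unusedSimpArgs false
set_option linter.unusedVariables false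

namespace SCG
open FreeGroup

variable {α : Type}

/-- words -/
abbrev Wd (α : Type) := List (α × Bool)

/-- inverse letter -/
def bar (e : α × Bool) : α × Bool := (e.1, !e.2)

theorem bar_bar (e : α × Bool) : bar (bar e) = e := by simp [bar]

theorem invRev_single (e : α × Bool) : invRev [e] = [bar e] := by simp [invRev, bar]

theorem invRev_cons' (e : α × Bool) (L : Wd α) : invRev (e :: L) = invRev L ++ [bar e] := by
  simp [invRev, bar]

theorem mk_app (a b : Wd α) : mk (a ++ b) = mk a * mk b := (mul_mk).symm

theorem mk_inv (a : Wd α) : mk (invRev a) = (mk a)⁻¹ := inv_mk.symm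

theorem mk_nil' : mk ([] : Wd α) = 1 := rfl

/-- generator attached to a letter -/
def gen (e : α × Bool) : FreeGroup α := mk [e]

theorem mk_cons' (e : α × Bool) (L : Wd α) : mk (e :: L) = gen e * mk L := by
  rw [gen, mul_mk]; rfl

theorem mk_bar (e : α × Bool) : gen (bar e) = (gen e)⁻¹ := by
  rw [gen, gen, ← invRev_single, mk_inv]

/-- reduced -/
def Red (L : Wd α) : Prop := ∀ a e b, L ≠ a ++ e :: bar e :: b

/-- cyclically reduced -/
def CR (L : Wd α) : Prop := ∀ e M, ¬ L ~r (e :: bar e :: M)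

theorem Red.sub {a b c : Wd α} (h : Red (a ++ b ++ c)) : Red b := by
  rintro x e y rfl
  exact h (a ++ x) e (y ++ c) (by simp)

theorem Red.left {a b : Wd α} (h : Red (a ++ b)) : Red a :=
  Red.sub (a := []) (c := b) (by simpa using h)

theorem Red.right {a b : Wd α} (h : Red (a ++ b)) : Red b :=
  Red.sub (a := a) (c := []) (by simpa using h)

theorem CR.rot {L M : Wd α} (h : CR L) (hr : L ~r M) : CR M := fun e N hN => h e N (hr.trans hN)

theorem CR.red {L : Wd α} (h : CR L) : Red L := by
  rintro a e b rfl
  exact h e (b ++ a) (by simpa using (List.isRotated_append : (a ++ e :: bar e :: b) ~r _))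

theorem CR.redrot {L M : Wd α} (h : CR L) (hr : L ~r M) : Red M := (h.rot hr).red

theorem rot_comm (a b : Wd α) : (a ++ b) ~r (b ++ a) := List.isRotated_append

theorem rot_iff {L M : Wd α} : L ~r M ↔ ∃ a b, L = a ++ b ∧ M = b ++ a := by
  constructor
  · rintro ⟨n, rfl⟩
    refine ⟨L.take (n % L.length), L.drop (n % L.length), by simp, ?_⟩
    exact List.rotate_eq_drop_append_take_mod
  · rintro ⟨a, b, rfl, rfl⟩; exact rot_comm a b

/-- reduced but not cyclically reduced -/
theorem not_CR {L : Wd α} (h : Red L) (hc : ¬ CR L) : ∃ e M, L = e :: M ++ [bar e] := by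
  unfold CR at hc
  push Not at hc
  obtain ⟨e, M, hr⟩ := hc
  obtain ⟨a, b, rfl, hM⟩ := rot_iff.1 hr
  rcases b with _ | ⟨f, b⟩
  · simp at hM; subst hM; exact absurd (by simp) (h [] e M)
  · rcases b with _ | ⟨f', b⟩
    · simp at hM
      obtain ⟨rfl, rfl⟩ := hM
      exact ⟨bar e, M, by simp [bar_bar]⟩
    · simp at hM
      obtain ⟨rfl, rfl, rfl⟩ := hM
      exact absurd rfl (h a e b)

theorem CR_of {L : Wd α} (h : Red L) (hc : ∀ e M, L ≠ e :: M ++ [bar e]) : CR L := by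
  by_contra h'
  obtain ⟨e, M, hM⟩ := not_CR h h'
  exact hc e M hM

theorem CR.ends {e : α × Bool} {M : Wd α} (h : CR (e :: M ++ [bar e])) : False := by
  refine h (bar e) M ?_
  rw [bar_bar]
  exact rot_comm (e :: M) [bar e]

theorem Red.isReduced {L : Wd α} (h : Red L) : IsReduced L := by
  induction L with
  | nil => exact IsReduced.nil
  | cons x L ih =>
    have h1 : Red L := Red.right (a := [x]) h
    rcases L with _ | ⟨y, L⟩
    · exact IsReduced.singleton
    · rw [isReduced_cons_cons]
      refine ⟨?_, ih h1⟩
      intro hxy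
      by_contra hne
      refine h [] x L ?_
      have : y = bar x := by
        unfold bar
        ext
        · exact hxy.symm
        · simp; cases hx : x.2 <;> cases hy : y.2 <;> simp_all
      simp [this]

theorem Red_of_isReduced {L : Wd α} (h : IsReduced L) : Red L := by
  rintro a e b rfl
  have h2 : IsReduced (e :: bar e :: b) := List.IsChain.right_of_append h
  rw [isReduced_cons_cons] at h2
  simpa [bar] using h2.1 rfl

theorem Red.inv {L : Wd α} (h : Red L) : Red (invRev L) := by
  intro a e b hL
  have := congrArg invRev hL
  rw [invRev_invRev] at this
  refine h (invRev b) e (invRev a) ?_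
  rw [this]
  simp [invRev_append, invRev_cons', bar_bar]

theorem Red_nil : Red ([] : Wd α) := by intro a e b; simp

theorem rot_inv {L M : Wd α} (h : L ~r M) : invRev L ~r invRev M := by
  obtain ⟨a, b, rfl, rfl⟩ := rot_iff.1 h
  rw [invRev_append, invRev_append]; exact rot_comm _ _

theorem rot_conj {L M : Wd α} (h : L ~r M) : ∃ g, mk M = g * mk L * g⁻¹ := by
  obtain ⟨a, b, rfl, rfl⟩ := rot_iff.1 h
  exact ⟨(mk a)⁻¹, by simp only [mk_app]; group⟩

theorem Red_append {a b : Wd α} (ha : Red a) (hb : Red b)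
    (h : ∀ e a' b', a = a' ++ [e] → b ≠ bar e :: b') : Red (a ++ b) := by
  intro x e y hxy
  rcases List.append_eq_append_iff.1 hxy with ⟨z, h1, h2⟩ | ⟨z, h1, h2⟩
  · exact hb z e y h2
  · rcases z with _ | ⟨f, z⟩
    · simp at h2; exact hb [] e y (by simp [← h2])
    · simp at h2
      obtain ⟨rfl, h2⟩ := h2
      rcases z with _ | ⟨f', z⟩
      · simp at h2
        exact h e x y h1 h2.symm
      · simp at h2
        obtain ⟨rfl, h2⟩ := h2
        exact ha x e z h1

variable [DecidableEq α]

theorem Red.toWord {L : Wd α} (h : Red L) : (mk L).toWord = L := by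
  rw [toWord_mk]; exact h.isReduced.reduce_eq

theorem Red_toWord (x : FreeGroup α) : Red x.toWord := Red_of_isReduced isReduced_toWord

theorem Red.inj {L M : Wd α} (h : Red L) (h' : Red M) (e : mk L = mk M) : L = M := by
  rw [← h.toWord, ← h'.toWord, e]

theorem Red.ne_one {L : Wd α} (h : Red L) (h' : L ≠ []) : mk L ≠ 1 := by
  intro e; exact h' (h.inj Red_nil (by rw [e]; rfl))

theorem short_of_not_red {L : Wd α} (h : ¬ Red L) : (mk L).toWord.length < L.length := by
  unfold Red at h
  push Not at h
  obtain ⟨a, e, b, rfl⟩ := h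
  have : mk (a ++ e :: bar e :: b) = mk (a ++ b) := by
    simp only [mk_app, mk_inv, mk_cons', mk_nil', mk_bar]; group
  rw [this]
  have := norm_mk_le (L₁ := a ++ b)
  unfold FreeGroup.norm at this
  simp at this ⊢; omega

theorem conjForm {W : Wd α} (hW : CR W) (hne : W ≠ []) (h : Wd α) :
    ∃ k V, W ~r V ∧ mk h * mk W * (mk h)⁻¹ = mk (k ++ V ++ invRev k) ∧
      Red (k ++ V ++ invRev k) := by
  induction h with
  | nil => exact ⟨[], W, List.IsRotated.refl _, by simp [mk_nil'], by simpa using hW.red⟩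
  | cons e h ih =>
    obtain ⟨k, V, hV, heq, hred⟩ := ih
    have hg : mk (e :: h) * mk W * (mk (e :: h))⁻¹ = mk [e] * mk (k ++ V ++ invRev k) * (mk [e])⁻¹ := by
      rw [← heq]; simp only [mk_app, mk_inv, mk_cons', mk_nil', mk_bar]; group
    rw [hg]
    have hVne : V ≠ [] := by
      rintro rfl; exact hne (by simpa using hV)
    have hVcr : CR V := hW.rot hV
    rcases k with _ | ⟨f, k⟩
    · by_cases h1 : ∃ M, V = bar e :: M
      · obtain ⟨M, rfl⟩ := h1
        refine ⟨[], M ++ [bar e], hV.trans (rot_comm [bar e] M), ?_, ?_⟩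
        · simp only [mk_app, mk_inv, mk_cons', mk_nil', mk_bar]; group
        · simpa using hVcr.redrot (rot_comm [bar e] M)
      · by_cases h2 : ∃ M, V = M ++ [e]
        · obtain ⟨M, rfl⟩ := h2
          refine ⟨[], e :: M, hV.trans (rot_comm M [e]), ?_, ?_⟩
          · simp only [mk_app, mk_inv, mk_cons', mk_nil', mk_bar]; group
          · simpa using hVcr.redrot (rot_comm M [e])
        · refine ⟨[e], V, hV, ?_, ?_⟩
          · simp only [mk_app, mk_inv, mk_cons', mk_nil', mk_bar]; group
          · rw [invRev_single]
            refine Red_append (Red_append ?_ hVcr.red ?_) ?_ ?_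
            · intro a f b; rcases a with _ | ⟨_, a⟩ <;> simp
            · intro f a' b' h3 h4
              rcases a' with _ | ⟨_, a⟩
              · simp at h3; subst h3; exact h1 ⟨_, h4⟩
              · simp at h3
            · intro a f b; rcases a with _ | ⟨_, a⟩ <;> simp
            · intro f a' b' h3 h4
              simp at h4
              obtain ⟨h4, rfl⟩ := h4
              have : e = f := by rw [← bar_bar e, h4, bar_bar]
              subst this
              rcases List.eq_nil_or_concat V with h5 | ⟨M, x, h5⟩
              · exact hVne h5
              · rw [h5, List.concat_eq_append, ← List.append_assoc] at h3
                rw [List.append_inj_right' h3 rfl |> List.singleton_injective, List.concat_eq_append] at h5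
                exact h2 ⟨M, h5⟩
    · by_cases h1 : f = bar e
      · subst h1
        refine ⟨k, V, hV, ?_, ?_⟩
        · simp only [mk_app, mk_inv, mk_cons', mk_nil', mk_bar]; group
        · refine Red.sub (a := [bar e]) (c := [e]) ?_
          rw [invRev_cons', bar_bar] at hred
          simpa using hred
      · refine ⟨e :: f :: k, V, hV, ?_, ?_⟩
        · simp only [mk_app, mk_inv, mk_cons', mk_nil', mk_bar]; group
        · have : e :: f :: k ++ V ++ invRev (e :: f :: k) = [e] ++ (f :: k ++ V ++ invRev (f :: k)) ++ [bar e] := by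
            rw [invRev_cons' e]; simp
          rw [this]
          refine Red_append (Red_append ?_ hred ?_) ?_ ?_
          · intro a f b; rcases a with _ | ⟨_, a⟩ <;> simp
          · intro f' a' b' h3 h4
            rcases a' with _ | ⟨_, a⟩
            · simp at h3; subst h3; simp at h4; exact h1 h4.1
            · simp at h3
          · intro a f b; rcases a with _ | ⟨_, a⟩ <;> simp
          · intro f' a' b' h3 h4
            simp at h4
            obtain ⟨h4, rfl⟩ := h4
            have : e = f' := by rw [← bar_bar e, h4, bar_bar]
            subst this
            rw [invRev_cons', ← List.append_assoc, ← List.append_assoc] at h3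
            have := List.append_inj_right' h3 rfl |> List.singleton_injective
            exact h1 (by rw [← this, bar_bar])

theorem conj_rot {W X : Wd α} (hW : CR W) (hX : CR X) (hne : W ≠ []) (h : FreeGroup α)
    (e : mk X = h * mk W * h⁻¹) : W ~r X := by
  obtain ⟨k, V, hV, h1, h2⟩ := conjForm hW hne h.toWord
  rw [mk_toWord, ← e] at h1
  have h3 := hX.red.inj h2 h1
  rcases k with _ | ⟨f, k⟩
  · simpa [h3] using hV
  · rw [invRev_cons'] at h3
    have : X = f :: (k ++ V ++ invRev k) ++ [bar f] := by rw [h3]; simp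
    rw [this] at hX
    exact hX.ends.elim

/-- cyclic reduction -/
theorem cycRed (n : ℕ) : ∀ L : Wd α, L.length ≤ n → Red L → ∃ k c, L = k ++ c ++ invRev k ∧ CR c := by
  induction n with
  | zero => 
    intro L hL h
    refine ⟨[], L, by simp, CR_of h ?_⟩
    rintro e M rfl; simp at hL
  | succ n ih =>
    intro L hL h
    by_cases hc : CR L
    · exact ⟨[], L, by simp, hc⟩
    · obtain ⟨e, M, rfl⟩ := not_CR h hc
      obtain ⟨k, c, rfl, h2⟩ := ih M (by simp at hL; omega) (Red.sub (a := [e]) (c := [bar e]) (by simpa using h))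
      exact ⟨e :: k, c, by simp [invRev_cons'], h2⟩

end SCG

set_option linter.unusedSectionVars false
set_option linter.unusedSimpArgs false
set_option linter.unusedVariables false

namespace SCG
open FreeGroup
variable {α : Type} [DecidableEq α]

/-- small cancellation data, in terms of words -/
structure SC (lam : ℝ) (Rel : Wd α → Prop) : Prop where
  pos : 0 < lam
  small : lam ≤ 1 / 100
  cr : ∀ {L}, Rel L → CR L
  rot : ∀ {a b}, Rel (a ++ b) → Rel (b ++ a)
  inv : ∀ {L}, Rel L → Rel (invRev L)
  piece : ∀ {b x y}, Rel (b ++ x) → Rel (b ++ y) → x ≠ y →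
    (b.length : ℝ) < lam * ((b ++ x).length : ℝ)
  len : ∀ {L}, Rel L → 2 / lam + 1 ≤ (L.length : ℝ)

/-- area at most n -/
inductive Ar (Rel : Wd α → Prop) : ℕ → FreeGroup α → Prop
  | one (n : ℕ) : Ar Rel n 1
  | step (n : ℕ) (x h : FreeGroup α) (L : Wd α) : Rel L → Ar Rel n x →
      Ar Rel (n + 1) (h * mk L * h⁻¹ * x)

variable {lam : ℝ} {Rel : Wd α → Prop}

theorem SC.L200 (S : SC lam Rel) {L : Wd α} (h : Rel L) : 2 < lam * (L.length : ℝ) := by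
  have h1 := S.len h
  have h0 := S.pos
  have : lam * (2 / lam + 1) ≤ lam * (L.length : ℝ) := by gcongr
  have h2 : lam * (2 / lam + 1) = 2 + lam := by field_simp
  linarith

theorem SC.ne_nil (S : SC lam Rel) {L : Wd α} (h : Rel L) : L ≠ [] := by
  rintro rfl
  have := S.L200 h
  norm_num at this

theorem SC.mk_ne_one (S : SC lam Rel) {L : Wd α} (h : Rel L) : FreeGroup.mk L ≠ 1 :=
  (S.cr h).red.ne_one (S.ne_nil h)

theorem SC.piece' (S : SC lam Rel) {b x y : Wd α} (h : Rel (b ++ x)) (h' : Rel (b ++ y)) (hn : x ≠ y) :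
    (b.length : ℝ) < lam * ((b ++ y).length : ℝ) := S.piece h' h (Ne.symm hn)

theorem SC.rotr (S : SC lam Rel) {L M : Wd α} (h : Rel L) (hr : L ~r M) : Rel M := by
  obtain ⟨a, b, rfl, rfl⟩ := rot_iff.1 hr
  exact S.rot h

namespace Ar

theorem mono {n m : ℕ} {x : FreeGroup α} (h : Ar Rel n x) (hm : n ≤ m) : Ar Rel m x := by
  induction h generalizing m with
  | one n => exact one m
  | step n x h L hL hx ih =>
    obtain ⟨k, rfl⟩ : ∃ k, m = k + 1 := ⟨m - 1, by omega⟩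
    exact step k x h L hL (ih (by omega))

theorem mul {n m : ℕ} {x y : FreeGroup α} (h : Ar Rel n x) (h' : Ar Rel m y) : Ar Rel (n + m) (x * y) := by
  induction h with
  | one n => simpa using h'.mono (by omega)
  | step n x h L hL hx ih =>
    rw [mul_assoc]
    have := step (n + m) (x * y) h L hL ih
    rwa [show n + m + 1 = n + 1 + m by omega] at this

theorem conj {n : ℕ} {x : FreeGroup α} (h : Ar Rel n x) (g : FreeGroup α) : Ar Rel n (g * x * g⁻¹) := by
  induction h with
  | one n => simpa using one n
  | step n x h L hL hx ih =>
    have := step n _ (g * h) L hL ih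
    have e : g * h * mk L * (g * h)⁻¹ * (g * x * g⁻¹) = g * (h * mk L * h⁻¹ * x) * g⁻¹ := by group
    rwa [e] at this

theorem tr {n : ℕ} {x y : FreeGroup α} (h : Ar Rel n x) (g : FreeGroup α) (e : y = g * x * g⁻¹) :
    Ar Rel n y := e ▸ h.conj g

theorem rel {L : Wd α} (h : Rel L) : Ar Rel 1 (mk L) := by
  simpa using step 0 1 1 L h (one 0)

theorem zero {x : FreeGroup α} (h : Ar Rel 0 x) : x = 1 := by
  cases h; rfl

theorem inv (S : SC lam Rel) {n : ℕ} {x : FreeGroup α} (h : Ar Rel n x) : Ar Rel n x⁻¹ := by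
  induction h with
  | one n => simpa using one n
  | step n x h L hL hx ih =>
    have := ih.mul ((rel (S.inv hL)).conj h)
    rw [mk_inv] at this
    have e : (h * mk L * h⁻¹ * x)⁻¹ = x⁻¹ * (h * (mk L)⁻¹ * h⁻¹) := by group
    rwa [e]

end Ar

/-- exact area -/
def Exact (Rel : Wd α → Prop) (n : ℕ) (x : FreeGroup α) : Prop :=
  Ar Rel n x ∧ ∀ m, Ar Rel m x → n ≤ m

theorem Exact.conj {n : ℕ} {x y : FreeGroup α} (h : Exact Rel n x) (g : FreeGroup α) (e : y = g * x * g⁻¹) :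
    Exact Rel n y :=
  ⟨h.1.tr g e, fun m hm => h.2 m (hm.tr g⁻¹ (by rw [e]; group))⟩

theorem Exact.rot {n : ℕ} {L M : Wd α} (h : Exact Rel n (mk L)) (hr : L ~r M) : Exact Rel n (mk M) := by
  obtain ⟨g, hg⟩ := rot_conj hr
  exact h.conj g hg

theorem exact_of {n : ℕ} {x : FreeGroup α} (h : Ar Rel n x) : ∃ m, m ≤ n ∧ Exact Rel m x := by
  classical
  have hx : ∃ m, Ar Rel m x := ⟨n, h⟩
  exact ⟨Nat.find hx, Nat.find_min' hx h, Nat.find_spec hx, fun m hm => Nat.find_min' hx hm⟩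

theorem Exact.pos {n : ℕ} {x : FreeGroup α} (h : Exact Rel n x) (hx : x ≠ 1) : 1 ≤ n := by
  rcases n with _ | n
  · exact absurd h.1.zero hx
  · omega

theorem Exact.ne_one {n : ℕ} {x : FreeGroup α} (h : Exact Rel n x) (hn : 1 ≤ n) : x ≠ 1 := by
  rintro rfl
  have := h.2 0 (Ar.one 0); omega

/-- segment weights -/
noncomputable def phi (lam : ℝ) (p : Wd α × Wd α) : ℤ :=
  if (p.2.length : ℝ) < lam * (p.1.length + p.2.length) then 3
  else if (p.2.length : ℝ) < 2 * lam * (p.1.length + p.2.length) then 2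
  else if (p.2.length : ℝ) < 3 * lam * (p.1.length + p.2.length) then 1
  else if (p.1.length : ℝ) < lam * (p.1.length + p.2.length) then -1
  else 0

theorem phi_le (p : Wd α × Wd α) : phi lam p ≤ 3 := by unfold phi; split_ifs <;> norm_num
theorem phi_ge (p : Wd α × Wd α) : -1 ≤ phi lam p := by unfold phi; split_ifs <;> norm_num

theorem phi_pos {p : Wd α × Wd α} (S : SC lam Rel) (h : 1 ≤ phi lam p) :
    (p.2.length : ℝ) < 3 * lam * (p.1.length + p.2.length) := by
  unfold phi at h
  have := S.pos
  have h3 : 0 ≤ lam * ((p.1.length : ℝ) + p.2.length) := by positivity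
  split_ifs at h <;> nlinarith

theorem phi_three {p : Wd α × Wd α} (h : 3 ≤ phi lam p) :
    (p.2.length : ℝ) < lam * (p.1.length + p.2.length) := by
  unfold phi at h
  split_ifs at h <;> first | assumption | norm_num at h

theorem phi_neg (S : SC lam Rel) {p : Wd α × Wd α} (h : (p.1.length : ℝ) < lam * (p.1.length + p.2.length)) :
    phi lam p = -1 := by
  have h1 : lam * (p.1.length + p.2.length) ≤ 1 / 100 * ((p.1.length : ℝ) + p.2.length) := by
    gcongr; exact S.small
  unfold phi
  split_ifs <;> first | rfl | (exfalso; linarith)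

theorem phi_cut1 (S : SC lam Rel) {p q : Wd α × Wd α} {d : ℝ}
    (hL : (q.1.length : ℝ) + q.2.length = p.1.length + p.2.length)
    (hd : d < lam * (p.1.length + p.2.length))
    (hq : (q.1.length : ℝ) + d = p.1.length) :
    phi lam p - 1 ≤ phi lam q := by
  have h0 : 0 ≤ lam * ((p.1.length : ℝ) + p.2.length) := by have := S.pos; positivity
  have h1 : lam * (p.1.length + p.2.length) ≤ 1 / 100 * ((p.1.length : ℝ) + p.2.length) := by
    gcongr; exact S.small
  unfold phi
  rw [hL]
  split_ifs <;> first | (exfalso; linarith) | norm_num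

set_option maxHeartbeats 1000000 in
theorem phi_cut2 (S : SC lam Rel) {p q q' : Wd α × Wd α} {d : ℝ}
    (hL : (q.1.length : ℝ) + q.2.length = p.1.length + p.2.length)
    (hL' : (q'.1.length : ℝ) + q'.2.length = p.1.length + p.2.length)
    (hd : d < lam * (p.1.length + p.2.length))
    (hq : (q.1.length : ℝ) + q'.1.length + d = p.1.length) :
    phi lam p - 3 ≤ phi lam q + phi lam q' := by
  have h0 : 0 ≤ lam * ((p.1.length : ℝ) + p.2.length) := by have := S.pos; positivity
  have h1 : lam * (p.1.length + p.2.length) ≤ 1 / 100 * ((p.1.length : ℝ) + p.2.length) := by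
    gcongr; exact S.small
  unfold phi
  rw [hL, hL']
  simp only [mul_assoc]
  generalize lam * ((p.1.length : ℝ) + p.2.length) = P at *
  generalize (p.1.length : ℝ) = a at *
  generalize (p.2.length : ℝ) = b at *
  generalize (q.1.length : ℝ) = c at *
  generalize (q.2.length : ℝ) = d at *
  generalize (q'.1.length : ℝ) = c' at *
  generalize (q'.2.length : ℝ) = d' at *
  split_ifs <;> first | (exfalso; linarith) | norm_num

/-- concatenation of the first components -/
def cat : List (Wd α × Wd α) → Wd α
  | [] => []
  | p :: l => p.1 ++ cat l

@[simp] theorem cat_nil : cat ([] : List (Wd α × Wd α)) = [] := rfl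
@[simp] theorem cat_cons (p : Wd α × Wd α) (l) : cat (p :: l) = p.1 ++ cat l := rfl
@[simp] theorem cat_append (l m : List (Wd α × Wd α)) : cat (l ++ m) = cat l ++ cat m := by
  induction l with
  | nil => rfl
  | cons p l ih => simp [ih]

/-- total weight -/
noncomputable def wt (lam : ℝ) : List (Wd α × Wd α) → ℤ
  | [] => 0
  | p :: l => phi lam p + wt lam l

@[simp] theorem wt_nil : wt lam ([] : List (Wd α × Wd α)) = 0 := rfl
@[simp] theorem wt_cons (p : Wd α × Wd α) (l) : wt lam (p :: l) = phi lam p + wt lam l := rfl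
@[simp] theorem wt_append (l m : List (Wd α × Wd α)) : wt lam (l ++ m) = wt lam l + wt lam m := by
  induction l with
  | nil => simp
  | cons p l ih => simp [ih]; ring

theorem wt_pos {l : List (Wd α × Wd α)} (h : 1 ≤ wt lam l) : ∃ l1 p l2, l = l1 ++ p :: l2 ∧ 1 ≤ phi lam p := by
  induction l with
  | nil => simp at h
  | cons p l ih =>
    by_cases hp : 1 ≤ phi lam p
    · exact ⟨[], p, l, rfl, hp⟩
    · simp at h
      obtain ⟨l1, q, l2, rfl, h2⟩ := ih (by omega)
      exact ⟨p :: l1, q, l2, rfl, h2⟩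

theorem wt_three {l : List (Wd α × Wd α)} (h : 3 ≤ wt lam l) :
    (∃ l1 p l2, l = l1 ++ p :: l2 ∧ 3 ≤ phi lam p) ∨
    (∃ l1 p l2 q l3, l = l1 ++ p :: l2 ++ q :: l3 ∧ 1 ≤ phi lam p ∧ 1 ≤ phi lam q) := by
  obtain ⟨l1, p, l2, rfl, hp⟩ := wt_pos (show 1 ≤ wt lam l by omega)
  by_cases h3 : 3 ≤ phi lam p
  · exact Or.inl ⟨l1, p, l2, rfl, h3⟩
  · right
    simp at h
    by_cases h1 : 1 ≤ wt lam l1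
    · obtain ⟨m1, q, m2, rfl, hq⟩ := wt_pos h1
      exact ⟨m1, q, m2, p, l2, by simp, hq, hp⟩
    · obtain ⟨m1, q, m2, rfl, hq⟩ := wt_pos (show 1 ≤ wt lam l2 by omega)
      exact ⟨l1, p, m1, q, m2, by simp, hp, hq⟩

/-- evidence: every segment can be replaced lowering the area -/
def Ev (Rel : Wd α → Prop) (n : ℕ) : FreeGroup α → List (Wd α × Wd α) → FreeGroup α → Prop
  | _, [], _ => True
  | p, x :: l, q => Rel (x.1 ++ x.2) ∧ Ar Rel n (p * (mk x.2)⁻¹ * mk (cat l) * q) ∧ Ev Rel n (p * mk x.1) l q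

theorem Ev.map {n m : ℕ} {l : List (Wd α × Wd α)} : ∀ {p q p' q' : FreeGroup α}, Ev Rel n p l q →
    (∀ x, Ar Rel n (p * x * q) → Ar Rel m (p' * x * q')) → Ev Rel m p' l q' := by
  induction l with
  | nil => intros; trivial
  | cons s l ih =>
    intro p q p' q' h hf
    obtain ⟨h1, h2, h3⟩ := h
    refine ⟨h1, ?_, ih h3 ?_⟩
    · have := hf ((mk s.2)⁻¹ * mk (cat l)) (by simpa [mul_assoc] using h2)
      simpa [mul_assoc] using this
    · intro x hx
      have := hf (mk s.1 * x) (by simpa [mul_assoc] using hx)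
      simpa [mul_assoc] using this

theorem Ev_append {n : ℕ} {l m : List (Wd α × Wd α)} : ∀ {p q : FreeGroup α},
    Ev Rel n p (l ++ m) q ↔ Ev Rel n p l (mk (cat m) * q) ∧ Ev Rel n (p * mk (cat l)) m q := by
  induction l with
  | nil => intro p q; simp [Ev, mk_nil']
  | cons s l ih =>
    intro p q
    simp only [List.cons_append, Ev, ih, cat_append, cat_cons, mk_app]
    simp only [mul_assoc]
    tauto

theorem Ev.rel {n : ℕ} {l1 l2 : List (Wd α × Wd α)} {p q : FreeGroup α} {x : Wd α × Wd α}
    (h : Ev Rel n p (l1 ++ x :: l2) q) : Rel (x.1 ++ x.2) := (Ev_append.1 h).2.1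

theorem Ev.ar {n : ℕ} {l1 l2 : List (Wd α × Wd α)} {p q : FreeGroup α} {x : Wd α × Wd α}
    (h : Ev Rel n p (l1 ++ x :: l2) q) :
    Ar Rel n (p * mk (cat l1) * (mk x.2)⁻¹ * mk (cat l2) * q) := (Ev_append.1 h).2.2.1

end SCG

set_option linter.unusedSectionVars false
set_option linter.unusedSimpArgs false
set_option linter.unusedVariables false

namespace SCG
open FreeGroup
variable {α : Type} [DecidableEq α] {lam : ℝ} {Rel : Wd α → Prop}

/-- shells exist in reduced words of area n -/
def SH (lam : ℝ) (Rel : Wd α → Prop) (n : ℕ) : Prop :=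
  ∀ Y : Wd α, Red Y → Exact Rel n (mk Y) → 1 ≤ n →
    ∃ x a y b, Y = x ++ a ++ y ∧ Rel (a ++ b) ∧ (b.length : ℝ) < 3 * lam * ((a ++ b).length : ℝ) ∧
      Ar Rel (n - 1) (mk x * (mk b)⁻¹ * mk y)

/-- the word decomposes additively -/
def Split (Rel : Wd α → Prop) (n : ℕ) (W : Wd α) : Prop :=
  ∃ g v u m1 m2, W ~r (g ++ v ++ invRev g ++ u) ∧ mk v ≠ 1 ∧ mk u ≠ 1 ∧
    Ar Rel m1 (mk v) ∧ Ar Rel m2 (mk u) ∧ m1 + m2 ≤ n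

theorem lexmin {β : Type} (P : β → Prop) (f g : β → ℕ) (h : ∃ b, P b) :
    ∃ b, P b ∧ ∀ b', P b' → f b ≤ f b' ∧ (f b' = f b → g b ≤ g b') := by
  obtain ⟨b0, h0, hb0⟩ := (measure f).wf.has_min {b | P b} h
  obtain ⟨b1, h1, hb1⟩ := (measure g).wf.has_min {b | P b ∧ f b = f b0} ⟨b0, h0, rfl⟩
  refine ⟨b1, h1.1, fun b' hb' => ⟨?_, fun he => ?_⟩⟩
  · rw [h1.2]; exact not_lt.1 (hb0 b' hb')
  · exact not_lt.1 (hb1 b' ⟨hb', he.trans h1.2⟩)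

theorem SC.mirror (S : SC lam Rel) {a b c : Wd α} (h : Rel (a ++ b)) (h' : Rel (a ++ c))
    (hb : (b.length : ℝ) < 3 * lam * ((a ++ b).length : ℝ)) : b = c := by
  by_contra hne
  have h1 := S.piece h h' hne
  have h2 := S.L200 h
  have h3 := S.small
  have h4 : lam * ((a ++ b).length : ℝ) ≤ 1 / 100 * ((a ++ b).length : ℝ) := by gcongr
  have h5 : ((a ++ b).length : ℝ) = a.length + b.length := by simp
  nlinarith

theorem SC.a_ne_nil (S : SC lam Rel) {a b : Wd α} (h : Rel (a ++ b))
    (hb : (b.length : ℝ) < 3 * lam * ((a ++ b).length : ℝ)) : a ≠ [] := by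
  rintro rfl
  have h2 := S.L200 h
  have h3 := S.small
  simp at hb h2
  have h4 : lam * (b.length : ℝ) ≤ 1 / 100 * (b.length : ℝ) := by gcongr
  nlinarith

theorem inside (S : SC lam Rel) {m : ℕ} (sh : SH lam Rel m) (hm : 1 ≤ m) {Y s : Wd α} (hY : Red Y)
    (hx : Exact Rel m (mk Y)) (hr : Rel (Y ++ s)) : Ar Rel (m - 1) (mk s) := by
  obtain ⟨x, a, y, b, rfl, h1, h2, h3⟩ := sh Y hY hx hm
  have h4 : Rel (a ++ (y ++ s ++ x)) := by
    refine S.rotr hr ?_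
    have := rot_comm x (a ++ y ++ s)
    simpa using this
  have := S.mirror h1 h4 h2
  subst this
  have := (h3.inv S).tr 1 (y := mk s) (by simp only [mk_app]; group)
  exact this

theorem cons_of_ne {L : Wd α} (h : L ≠ []) : ∃ e M, L = e :: M := by
  cases L with
  | nil => exact absurd rfl h
  | cons e M => exact ⟨e, M, rfl⟩

theorem concat_of_ne {L : Wd α} (h : L ≠ []) : ∃ M e, L = M ++ [e] := by
  rcases List.eq_nil_or_concat L with h' | ⟨M, e, h'⟩
  · exact absurd h' h
  · exact ⟨M, e, by simpa using h'⟩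

theorem E_lemma (S : SC lam Rel) {m : ℕ} (hm : 1 ≤ m) (sh : SH lam Rel m) {W : Wd α} (hW : CR W)
    (hx : Exact Rel (m + 1) (mk W)) : Split Rel (m + 1) W ∨
      ∃ s t q, W ~r (s ++ t) ∧ Rel (s ++ q) ∧ Ar Rel m ((mk q)⁻¹ * mk t) ∧ CR (invRev q ++ t) := by
  have hWne : W ≠ [] := by
    rintro rfl
    exact hx.ne_one (by omega) rfl
  let P : Wd α × Wd α × Wd α → Prop := fun p => Rel (p.1 ++ p.2.1) ∧ Red (p.1 ++ p.2.2) ∧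
    (∃ g, mk (p.1 ++ p.2.2) = g * mk W * g⁻¹) ∧ Ar Rel m ((mk p.2.1)⁻¹ * mk p.2.2)
  have hex : ∃ p, P p := by
    have h1 := hx.1
    generalize hz : mk W = z at h1
    cases h1 with
    | one => exact absurd hz (hx.ne_one (by omega))
    | step _ y h L hL hy =>
      refine ⟨([], L, (h⁻¹ * mk W * h).toWord), by simpa using hL, by simpa using Red_toWord _,
        ⟨h⁻¹, by simp [mk_toWord]⟩, ?_⟩
      simp only [mk_toWord]
      rw [hz]
      refine hy.tr h⁻¹ ?_
      group
  obtain ⟨⟨s, q, t⟩, ⟨hr, hxr, ⟨g, hg⟩, har⟩, hmin⟩ := lexmin P (fun p => p.1.length + p.2.2.length)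
    (fun p => p.2.2.length) hex
  simp only at hr hxr hg har hmin
  have hnew : ∀ s' q' t', Rel (s' ++ q') → (∃ g, mk (s' ++ t') = g * mk W * g⁻¹) →
      Ar Rel m ((mk q')⁻¹ * mk t') → s.length + t.length ≤ s'.length + t'.length ∧
        (s'.length + t'.length = s.length + t.length → t.length ≤ t'.length) := by
    intro s' q' t' h1 h2 h3
    by_cases h4 : Red (s' ++ t')
    · exact hmin (s', q', t') ⟨h1, h4, h2, h3⟩
    · have h5 := short_of_not_red h4
      have h6 := hmin ([], s' ++ q', (mk (s' ++ t')).toWord) ⟨by simpa using h1, Red_toWord (mk (s' ++ t')),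
        by simpa only [mk_toWord, List.nil_append] using h2, by
          simp only [mk_toWord]
          refine h3.tr 1 ?_
          simp only [mk_app]; group⟩
      simp only [List.length_nil, List.length_append] at h6 h5
      omega
  have hlb : ∀ k, Ar Rel k ((mk q)⁻¹ * mk t) → m ≤ k := by
    intro k hk
    have h1 := (Ar.rel hr).mul (hk.tr 1 rfl)
    have := hx.2 (1 + k) (h1.tr g⁻¹ (by
      have : mk W = g⁻¹ * mk (s ++ t) * g⁻¹⁻¹ := by rw [hg]; group
      rw [this]; simp only [mk_app]; group))
    omega
  have hxcr : s ≠ [] → CR (s ++ t) := by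
    intro hs
    by_contra hc
    obtain ⟨e, M, he⟩ := not_CR hxr hc
    obtain ⟨f, s', rfl⟩ := cons_of_ne hs
    have hef : f = e ∧ s' ++ t = M ++ [bar e] := by simpa using he
    obtain ⟨rfl, hM⟩ := hef
    have hM' : mk s' * mk t = mk M * (gen f)⁻¹ := by
      have := congrArg mk hM
      simpa only [mk_app, mk_cons', mk_bar, mk_nil', mul_one] using this
    have h1 := (hnew [] (s' ++ q ++ [f]) M
      (by simpa using S.rotr hr (rot_comm [f] (s' ++ q)))
      ⟨(gen f)⁻¹ * g, by
        have : mk M = (gen f)⁻¹ * mk (f :: s' ++ t) * gen f := by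
          simp only [mk_app, mk_cons']
          have := congrArg (· * gen f) hM'
          simp only [inv_mul_cancel_right] at this
          rw [← this]; group
        simp only [List.nil_append]
        rw [this, hg]; group⟩
      (by
        refine har.tr (gen f)⁻¹ ?_
        have : mk M = mk s' * mk t * gen f := by rw [hM']; group
        simp only [mk_app, mk_cons', mk_nil', this]; group)).1
    have h2 := congrArg List.length hM
    simp at h1 h2
    omega
  have hrot : s ≠ [] → W ~r (s ++ t) := fun hs => conj_rot hW (hxcr hs) hWne g hg
  by_cases hq : q = []
  · subst hq
    have hs : s ≠ [] := by simpa using S.ne_nil hr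
    left
    have ht : t ≠ [] := by
      rintro rfl
      have h1 := (hx.rot (hrot hs)).2 1 (by simpa using Ar.rel hr)
      omega
    refine ⟨[], s, t, 1, m, by simpa using hrot hs, S.mk_ne_one (by simpa using hr),
      hxr.right.ne_one ht, Ar.rel (by simpa using hr), har.tr 1 (by rw [mk_nil']; group), by omega⟩
  by_cases ht : t = []
  · subst ht
    exfalso
    have h1 : Exact Rel m (mk (invRev q)) := by
      rw [mk_inv]
      exact ⟨har.tr 1 (by rw [mk_nil']; group), fun k hk => hlb k (hk.tr 1 (by rw [mk_nil']; group))⟩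
    have h2 := inside S sh hm (S.cr hr).red.right.inv h1 (s := invRev s) (by
      rw [← invRev_append]; exact S.inv hr)
    have h3 := hx.2 (m - 1) ((h2.inv S).tr g⁻¹ (by
      have : mk W = g⁻¹ * mk (s ++ []) * g⁻¹⁻¹ := by rw [hg]; group
      rw [this]; simp only [mk_app, mk_inv, mk_nil']; group))
    omega
  have hcr : CR (invRev q ++ t) := by
    refine CR_of (Red_append (S.cr hr).red.right.inv hxr.right ?_) ?_
    · intro e a' b' h1 h2
      have h3 : q = bar e :: invRev a' := by
        rw [← invRev_invRev (L₁ := q), h1, invRev_append, invRev_single]; rfl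
      have := (hnew (s ++ [bar e]) (invRev a') b' (by simpa [h3] using hr) ⟨g, by rw [← hg, h2]; simp⟩
        (har.tr 1 (by
          rw [h3, h2]
          simp only [mk_app, mk_inv, mk_cons', mk_bar]; group))).2 (by rw [h2]; simp; omega)
      rw [h2] at this; simp at this
    · intro e M h1
      obtain ⟨t', f, rfl⟩ := concat_of_ne ht
      have hq' : invRev q ≠ [] := by
        intro h; apply hq; rw [← invRev_invRev (L₁ := q), h]; rfl
      obtain ⟨e', M1, h2⟩ := cons_of_ne hq'
      rw [h2] at h1
      have h4 : e' = e ∧ f = bar e := by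
        rw [← List.append_assoc] at h1
        have := List.append_inj_right' h1 rfl
        simp at h1 this
        exact ⟨h1.1, this⟩
      obtain ⟨rfl, rfl⟩ := h4
      have h3 : q = invRev M1 ++ [bar e'] := by
        rw [← invRev_invRev (L₁ := q), h2, invRev_cons']
      have := (hnew (bar e' :: s) (invRev M1) t' (by
          have := S.rotr hr (M := [bar e'] ++ (s ++ invRev M1)) (by
            rw [h3]; simpa using rot_comm (s ++ invRev M1) [bar e'])
          simpa using this) ⟨(gen e')⁻¹ * g, by
            have : mk (bar e' :: s ++ t') = (gen e')⁻¹ * mk (s ++ (t' ++ [bar e'])) * gen e' := by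
              simp only [mk_app, mk_inv, mk_cons', mk_bar, mk_nil']; group
            rw [this, hg]; group⟩
        (har.tr (gen e')⁻¹ (by
          rw [h3]
          simp only [mk_app, mk_inv, mk_cons', mk_bar, mk_nil']; group))).2 (by simp; omega)
      simp at this
  by_cases hs : s = []
  · exfalso
    subst hs
    simp only [List.nil_append] at hr hxr hg
    have hex2 : Exact Rel m (mk (invRev q ++ t)) := by
      rw [mk_app, mk_inv]
      exact ⟨har, hlb⟩
    obtain ⟨x, a, y, b, h1, h2, h3, h4⟩ := sh _ hcr.red hex2 hm
    have hane := S.a_ne_nil h2 h3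
    have hnew' : ∀ s' q' t', s' ≠ [] → Rel (s' ++ q') → (∃ g, mk (s' ++ t') = g * mk W * g⁻¹) →
      Ar Rel m ((mk q')⁻¹ * mk t') → s'.length + t'.length = t.length → False := by
      intro s' q' t' k1 k2 k3 k4 k5
      have := (hnew s' q' t' k2 k3 k4).2 (by simp; omega)
      have := List.length_pos_iff.2 k1
      omega
    have hqr : Rel (invRev q) := S.inv hr
    have hxW : ∀ k, Ar Rel k (mk t) → m + 1 ≤ k := fun k hk =>
      hx.2 k (hk.tr g⁻¹ (by rw [hg]; group))
    rw [List.append_assoc] at h1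
    rcases List.append_eq_append_iff.1 h1 with ⟨z, h5, h6⟩ | ⟨z, h5, h6⟩
    ·
      subst h5
      rw [← List.append_assoc] at h6
      subst h6
      refine hnew' a b (y ++ z) hane h2 ⟨(mk z)⁻¹ * g, ?_⟩ ?_ (by simp; omega)
      · have : mk (a ++ (y ++ z)) = (mk z)⁻¹ * mk (z ++ a ++ y) * mk z := by
          simp only [mk_app]; group
        rw [this, hg]; group
      · have := (Ar.rel hr).mul h4
        rw [show 1 + (m - 1) = m by omega] at this
        refine this.tr (mk z)⁻¹ ?_
        simp only [mk_app, mk_inv]; group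
    ·
      rcases List.append_eq_append_iff.1 h6 with ⟨z', h7, h8⟩ | ⟨z', h7, h8⟩
      ·
        subst h7
        rw [h5] at hqr
        have h9 := S.mirror h2 (c := z' ++ x) (by
          refine S.rotr hqr ?_
          simpa using rot_comm x (a ++ z')) h3
        subst h9
        have := hxW (m - 1) (h4.tr 1 (by rw [h8]; simp only [mk_app]; group))
        omega
      · by_cases hz : z' = []
        · subst hz
          simp only [List.append_nil] at h7
          simp only [List.nil_append] at h8
          subst h7
          rw [h5] at hqr
          have h9 := S.mirror h2 (c := x) (by
            refine S.rotr hqr ?_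
            simpa using rot_comm x a) h3
          subst h9
          have := hxW (m - 1) (h4.tr 1 (by rw [h8]; group))
          omega
        · subst h7
          refine hnew' z' (b ++ z) y hz ?_ ⟨g, by rw [← h8, hg]⟩ ?_ (by rw [h8]; simp)
          · refine S.rotr h2 ?_
            simpa using rot_comm z (z' ++ b)
          · have := (Ar.rel hr).mul h4
            rw [show 1 + (m - 1) = m by omega] at this
            refine this.tr 1 ?_
            have hq2 : mk q = (mk z)⁻¹ * (mk x)⁻¹ := by
              rw [← invRev_invRev (L₁ := q), h5, mk_inv, mk_app]; group
            rw [hq2]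
            simp only [mk_app, mk_inv]; group
  · exact Or.inr ⟨s, t, q, hrot hs, hr, har, hcr⟩

end SCG

set_option linter.unusedSectionVars false
set_option linter.unusedSimpArgs false
set_option linter.unusedVariables false

namespace SCG
open FreeGroup
variable {α : Type} [DecidableEq α] {lam : ℝ} {Rel : Wd α → Prop}

theorem splitMax {n : ℕ} {W : Wd α} (hW : CR W) (hx : Exact Rel n (mk W)) (hs : Split Rel n W) :
    ∃ g v u m1 m2, W ~r (g ++ v ++ invRev g ++ u) ∧ CR v ∧ CR u ∧ Exact Rel m1 (mk v) ∧
      Exact Rel m2 (mk u) ∧ 1 ≤ m1 ∧ 1 ≤ m2 ∧ m1 + m2 = n := by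
  let P : Wd α × Wd α × Wd α → Prop := fun p => ∃ m1 m2, W ~r (p.1 ++ p.2.1 ++ invRev p.1 ++ p.2.2) ∧
    mk p.2.1 ≠ 1 ∧ mk p.2.2 ≠ 1 ∧ Ar Rel m1 (mk p.2.1) ∧ Ar Rel m2 (mk p.2.2) ∧ m1 + m2 ≤ n
  have hex : ∃ p, P p := by
    obtain ⟨g, v, u, m1, m2, h⟩ := hs
    exact ⟨(g, v, u), m1, m2, h⟩
  obtain ⟨⟨g, v, u⟩, ⟨m1, m2, hr, hv, hu, h1, h2, h3⟩, hmin⟩ :=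
    lexmin P (fun p => p.2.1.length + p.2.2.length) (fun _ => 0) hex
  simp only at hr hv hu h1 h2 h3 hmin
  have hred : Red (g ++ v ++ invRev g ++ u) := hW.redrot hr
  have hvr : Red v := Red.sub (a := g) (c := invRev g ++ u) (by simpa using hred)
  have hur : Red u := hred.right
  have hvc : CR v := by
    refine CR_of hvr ?_
    rintro e M rfl
    have := (hmin (g ++ [e], M, u) ⟨m1, m2, by simpa [invRev_append, invRev_single] using hr, ?_, hu, ?_, h2, h3⟩).1
    · simp at this
    · intro h
      apply hv
      simp only [mk_app, mk_cons', mk_bar, mk_nil'] at h ⊢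
      rw [h]; group
    · refine h1.tr (gen e)⁻¹ ?_
      simp only [mk_app, mk_cons', mk_bar, mk_nil']; group
  have huc : CR u := by
    refine CR_of hur ?_
    rintro e M rfl
    have := (hmin (bar e :: g, v, M) ⟨m1, m2, ?_, hv, ?_, h1, ?_, h3⟩).1
    · simp at this
    · simp only
      refine hr.trans ?_
      rw [invRev_cons', bar_bar]
      have := rot_comm (g ++ v ++ invRev g ++ e :: M) [bar e]
      simpa using this
    · intro h
      apply hu
      simp only [mk_app, mk_cons', mk_bar, mk_nil'] at h ⊢
      rw [h]; group
    · refine h2.tr (gen e)⁻¹ ?_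
      simp only [mk_app, mk_cons', mk_bar, mk_nil']; group
  have key : ∀ k1 k2, Ar Rel k1 (mk v) → Ar Rel k2 (mk u) → n ≤ k1 + k2 := by
    intro k1 k2 hk1 hk2
    refine (hx.rot hr).2 _ (((hk1.conj (mk g)).mul hk2).tr 1 ?_)
    simp only [mk_app, mk_inv]; group
  have e1 : Exact Rel m1 (mk v) := ⟨h1, fun k hk => by have := key k m2 hk h2; omega⟩
  have e2 : Exact Rel m2 (mk u) := ⟨h2, fun k hk => by have := key m1 k h1 hk; omega⟩
  exact ⟨g, v, u, m1, m2, hr, hvc, huc, e1, e2, e1.pos hv, e2.pos hu, by have := key m1 m2 h1 h2; omega⟩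

/-- weight invariant -/
def Inv (lam : ℝ) (T : ℤ) (c L : ℝ) : Prop :=
  7 ≤ T ∨ (6 ≤ T ∧ c ≤ (1 - lam) * L) ∨ ∃ M : ℕ, 1 ≤ M ∧ (2 + M : ℤ) ≤ T ∧ c < M * lam * L

def CC (lam : ℝ) (Rel : Wd α → Prop) (n : ℕ) : Prop :=
  ∀ c t s : Wd α, CR (c ++ t) → Exact Rel n (mk (c ++ t)) → 1 ≤ n → Rel (s ++ invRev c) →
    (∀ m, Ar Rel m (mk s * mk t) → n + 1 ≤ m) →
    (∀ t1 x t2 m1 m2, t = t1 ++ x ++ t2 → mk x ≠ 1 → Ar Rel m1 (mk x) →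
      Ar Rel m2 (mk c * mk t1 * mk t2) → n < m1 + m2) →
    ∃ segs, cat segs = t ∧ Ev Rel n (mk s) segs 1 ∧
      Inv lam (wt lam segs) c.length (s ++ invRev c).length

def Dec (lam : ℝ) (Rel : Wd α → Prop) (n : ℕ) (W : Wd α) : Prop :=
  Rel W ∨ ∃ segs, cat segs ~r W ∧ Ev Rel (n - 1) 1 segs 1 ∧ 6 ≤ wt lam segs

def AA (lam : ℝ) (Rel : Wd α → Prop) (n : ℕ) : Prop :=
  ∀ W : Wd α, CR W → Exact Rel n (mk W) → 1 ≤ n → ¬ Split Rel n W → Dec lam Rel n W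

theorem catSplit : ∀ (segs : List (Wd α × Wd α)) (d e : Wd α), segs ≠ [] → cat segs = d ++ e →
    ∃ l1 a b v l2, segs = l1 ++ (a ++ b, v) :: l2 ∧ d = cat l1 ++ a ∧ e = b ++ cat l2 := by
  intro segs
  induction segs with
  | nil => intro d e h; exact absurd rfl h
  | cons p l ih =>
    intro d e _ h
    obtain ⟨u, v⟩ := p
    simp only [cat_cons] at h
    rcases List.append_eq_append_iff.1 h with ⟨z, h1, h2⟩ | ⟨z, h1, h2⟩
    · by_cases hl : l = []
      · subst hl
        simp at h2
        obtain ⟨rfl, rfl⟩ := h2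
        exact ⟨[], u, [], v, [], by simp, by simp [h1], by simp⟩
      · obtain ⟨l1, a, b, v', l2, rfl, h3, h4⟩ := ih z e hl h2
        exact ⟨(u, v) :: l1, a, b, v', l2, by simp, by simp [h1, h3], h4⟩
    · exact ⟨[], d, z, v, l, by simp [h1], by simp, h2⟩

theorem Ev.rot {n : ℕ} {l m : List (Wd α × Wd α)} (h : Ev Rel n 1 (l ++ m) 1) : Ev Rel n 1 (m ++ l) 1 := by
  rw [Ev_append] at h ⊢
  refine ⟨h.2.map fun x hx => ?_, h.1.map fun x hx => ?_⟩
  · refine hx.tr (mk (cat l))⁻¹ ?_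
    group
  · refine hx.tr (mk (cat m)) ?_
    group

theorem cutLemma {k : ℕ} {segs : List (Wd α × Wd α)} {Y : Wd α} (hne : segs ≠ [])
    (hr : cat segs ~r Y) (hev : Ev Rel k 1 segs 1) :
    ∃ a b v l, b ++ cat l ++ a = Y ∧ Ev Rel k 1 ((a ++ b, v) :: l) 1 ∧
      wt lam ((a ++ b, v) :: l) = wt lam segs := by
  obtain ⟨d, e, h1, rfl⟩ := rot_iff.1 hr
  obtain ⟨l1, a, b, v, l2, rfl, rfl, rfl⟩ := catSplit segs d e hne h1
  refine ⟨a, b, v, l2 ++ l1, by simp, ?_, by simp; ring⟩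
  have := hev.rot
  simpa using this

theorem contact (S : SC lam Rel) {n : ℕ} (hn : 1 ≤ n) {s c t : Wd α} (hr : Rel (s ++ invRev c))
    (hlb : ∀ m, Ar Rel m (mk s * mk t) → n + 1 ≤ m) {c1 d c2 d' : Wd α} (hc : c = c1 ++ d ++ c2)
    (hd : Rel (d ++ d')) (har : Ar Rel (n - 1) (mk c1 * (mk d')⁻¹ * mk c2 * mk t)) :
    (d.length : ℝ) < lam * ((s ++ invRev c).length : ℝ) ∧ (d.length : ℝ) < lam * (d.length + d'.length) := by
  have h1 : Rel (d ++ (c2 ++ invRev s ++ c1)) := by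
    have h2 := S.inv hr
    rw [invRev_append, invRev_invRev, hc] at h2
    refine S.rotr h2 ?_
    simpa using rot_comm c1 (d ++ c2 ++ invRev s)
  by_cases hne : d' = c2 ++ invRev s ++ c1
  · exfalso
    have := hlb (n - 1) (har.tr 1 (by rw [hne]; simp only [mk_app, mk_inv]; group))
    omega
  · have h2 := S.piece hd h1 hne
    have h3 := S.piece' hd h1 hne
    constructor
    · convert h3 using 3
      rw [hc]
      simp; omega
    · simpa using h2

theorem contactList (S : SC lam Rel) {n : ℕ} (hn : 1 ≤ n) {s c t : Wd α} (hr : Rel (s ++ invRev c))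
    (hlb : ∀ m, Ar Rel m (mk s * mk t) → n + 1 ≤ m) (l : List (Wd α × Wd α)) :
    ∀ c1 c2 : Wd α, c = c1 ++ cat l ++ c2 → Ev Rel (n - 1) (mk c1) l (mk c2 * mk t) →
    wt lam l = - (l.length : ℤ) ∧ ((cat l).length : ℝ) ≤ l.length * (lam * ((s ++ invRev c).length : ℝ)) := by
  induction l with
  | nil => intro c1 c2 _ _; simp
  | cons p l ih =>
    intro c1 c2 hc hev
    obtain ⟨h1, h2, h3⟩ := hev
    have h4 := contact S hn hr hlb (c1 := c1) (d := p.1) (c2 := cat l ++ c2) (by rw [hc]; simp) h1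
      (h2.tr 1 (by simp only [mk_app]; group))
    have h5 := ih (c1 ++ p.1) c2 (by rw [hc]; simp) (by rw [mk_app]; exact h3)
    have h6 := phi_neg S h4.2
    constructor
    · simp [h5.1, h6]
    · have := h4.1
      have := h5.2
      simp only [cat_cons, List.length_append, List.length_cons] at *
      push_cast at *
      linarith

theorem CC_unsplit (S : SC lam Rel) {n : ℕ} (hn : 1 ≤ n) {s c t : Wd α} (hr : Rel (s ++ invRev c))
    (hlb : ∀ m, Ar Rel m (mk s * mk t) → n + 1 ≤ m) (hdec : Dec lam Rel n (c ++ t)) :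
    ∃ segs, cat segs = t ∧ Ev Rel n (mk s) segs 1 ∧
      Inv lam (wt lam segs) c.length (s ++ invRev c).length := by
  have tr : ∀ l : List (Wd α × Wd α), Ev Rel (n - 1) (mk c) l 1 → Ev Rel n (mk s) l 1 := by
    intro l h
    refine h.map fun x hx => ?_
    have := (Ar.rel hr).mul hx
    rw [show 1 + (n - 1) = n by omega] at this
    refine this.tr 1 ?_
    simp only [mk_app, mk_inv]; group
  rcases hdec with h | ⟨segs, h1, h2, h3⟩
  · refine ⟨[(t, c)], by simp, ⟨S.rot h, ?_, trivial⟩, ?_⟩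
    · refine ((Ar.rel hr).mono hn).tr 1 ?_
      simp only [mk_app, mk_inv, cat_nil, mk_nil']; group
    · have h4 := contact S hn hr hlb (c1 := []) (d := c) (c2 := []) (d' := t) (by simp) h
        ((Ar.one _).tr 1 (by simp only [mk_nil']; group))
      refine Or.inr (Or.inr ⟨1, le_refl _, ?_, by simpa using h4.1⟩)
      have : phi lam (t, c) = 3 := by
        unfold phi
        rw [if_pos]
        have := h4.2
        simp only
        linarith
      simp [this]
  · have hne : segs ≠ [] := by rintro rfl; simp at h3
    obtain ⟨a, b, v, l, h4, h5, h6⟩ := cutLemma (lam := lam) hne h1 h2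
    rw [← h6] at h3
    clear h1 h2 h6 hne
    obtain ⟨hR, hA, hE⟩ := h5
    simp only [one_mul, mul_one] at hA hE hR
    rw [wt_cons] at h3
    have hRb : Rel (b ++ (v ++ a)) := S.rotr hR (by simpa using rot_comm a (b ++ v))
    have hRa : Rel (a ++ (b ++ v)) := by simpa using hR
    rw [List.append_assoc] at h4
    rcases List.append_eq_append_iff.1 h4 with ⟨c', h5, h6⟩ | ⟨b', h5, h6⟩
    ·
      subst h5
      have hb := contact S hn hr hlb (c1 := []) (d := b) (c2 := c') (d' := v ++ a) (by simp) hRb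
        (hA.tr (mk a)⁻¹ (by
          have := congrArg mk h6
          simp only [mk_app, mk_nil'] at this ⊢
          rw [mul_assoc _ (mk c'), ← this]; group))
      rcases List.append_eq_append_iff.1 h6 with ⟨a1, h7, h8⟩ | ⟨z, h7, h8⟩
      ·
        exfalso
        have h9 := contactList S hn hr hlb l b a1 (by rw [h7]; simp) (hE.map fun x hx => hx.tr (mk a)⁻¹ (by
          rw [h8]; simp only [mk_app]; group))
        have := phi_le (lam := lam) (a ++ b, v)
        omega
      · by_cases hl : l = []
        · subst hl
          simp at h7
          obtain ⟨rfl, rfl⟩ := h7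
          simp at h8
          subst h8
          refine ⟨[(t, b ++ v)], by simp, tr _ ⟨hRa, ?_, trivial⟩, Or.inr (Or.inr ⟨1, le_refl _, ?_, ?_⟩)⟩
          · refine hA.tr (mk b) ?_
            simp only [mk_app, cat_nil, mk_nil', List.append_nil]; group
          · have := phi_le (lam := lam) (t ++ b, v)
            simp at h3; omega
          · simpa using hb.1
        · obtain ⟨l', bj, aj, vj, l'', rfl, rfl, rfl⟩ := catSplit l _ _ hl h7
          rw [Ev_append] at hE
          obtain ⟨hE1, hE2⟩ := hE
          obtain ⟨hRj, hAj, hE3⟩ := hE2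
          simp only at hRj hAj hE3
          subst h8
          have hRbj : Rel (bj ++ (aj ++ vj)) := by simpa using hRj
          have hRaj : Rel (aj ++ (vj ++ bj)) := S.rotr hRj (by simpa using rot_comm bj (aj ++ vj))
          have hbj := contact S hn hr hlb (c1 := b ++ cat l') (d := bj) (c2 := []) (d' := aj ++ vj) (by simp) hRbj
            (hAj.tr (mk a)⁻¹ (by
              simp only [mk_app, mk_nil']; group))
          have hl' := contactList S hn hr hlb l' b (bj) (by simp) (hE1.map fun x hx => hx.tr (mk a)⁻¹ (by
            simp only [mk_app, cat_cons]; group))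
          have p1 := phi_cut1 S (p := (bj ++ aj, vj)) (q := (aj, vj ++ bj)) (d := bj.length)
            (by simp; ring) (by have := hbj.2; simp at this ⊢; linarith) (by simp; ring)
          have p2 := phi_cut1 S (p := (a ++ b, v)) (q := (a, b ++ v)) (d := b.length)
            (by simp; ring) (by have := hb.2; simp at this ⊢; linarith) (by simp)
          refine ⟨(aj, vj ++ bj) :: l'' ++ [(a, b ++ v)], by simp, tr _ ?_,
            Or.inr (Or.inr ⟨l'.length + 2, by omega, ?_, ?_⟩)⟩
          · refine Ev_append.2 ⟨⟨hRaj, ?_, ?_⟩, hRa, ?_, trivial⟩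
            · refine hAj.tr (mk a)⁻¹ ?_
              simp only [mk_app, cat_cons, cat_nil, mk_nil']; group
            · refine hE3.map fun x hx => hx.tr (mk a)⁻¹ ?_
              simp only [mk_app, cat_cons, cat_nil, mk_nil']; group
            · refine hA.tr (mk b * mk (cat (l' ++ (bj ++ aj, vj) :: l''))) ?_
              simp only [mk_app, cat_cons, cat_append, cat_nil, mk_nil']; group
          · simp at h3 ⊢
            omega
          · have := hl'.2
            have := hb.1
            have := hbj.1
            generalize ((s ++ invRev (b ++ (cat l' ++ bj))).length : ℝ) = L at *
            simp only [List.length_append]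
            push_cast
            nlinarith
    ·
      subst h5
      subst h6
      have hb := contact S hn hr hlb (c1 := []) (d := c) (c2 := []) (d' := b' ++ v ++ a) (by simp)
        (by simpa using hRb) (hA.tr (mk a)⁻¹ (by
          simp only [mk_app, mk_nil']; group))
      have p2 := phi_cut2 S (p := (a ++ (c ++ b'), v)) (q := (b', v ++ a ++ c)) (q' := (a, c ++ b' ++ v)) (d := c.length)
            (by simp; ring) (by simp; ring) (by have := hb.2; simp at this ⊢; linarith) (by simp; ring)
      refine ⟨(b', v ++ a ++ c) :: l ++ [(a, c ++ b' ++ v)], by simp, tr _ ?_,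
            Or.inr (Or.inr ⟨1, by omega, ?_, by simpa using hb.1⟩)⟩
      · refine Ev_append.2 ⟨⟨?_, ?_, ?_⟩, by simpa using hRa, ?_, trivial⟩
        · refine S.rotr hR ?_
          simpa using rot_comm (a ++ c) (b' ++ v)
        · refine hA.tr (mk a)⁻¹ ?_
          simp only [mk_app, cat_cons, cat_nil, mk_nil']; group
        · refine hE.map fun x hx => hx.tr (mk a)⁻¹ ?_
          simp only [mk_app, cat_cons, cat_nil, mk_nil']; group
        · refine hA.tr (mk c * mk b' * mk (cat l)) ?_
          simp only [mk_app, cat_cons, cat_append, cat_nil, mk_nil']; group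
      · simp only [wt_cons, wt_append, wt_nil, List.cons_append] at h3 ⊢
        push_cast
        omega

end SCG

set_option linter.unusedSectionVars false
set_option linter.unusedSimpArgs false
set_option linter.unusedVariables false

namespace SCG
open FreeGroup
variable {α : Type} [DecidableEq α] {lam : ℝ} {Rel : Wd α → Prop}

/-- relative position of a two arc and a four arc decomposition -/
def LL (c t x1 x2 x3 x4 : Wd α) : Prop :=
  (∃ c1 c2, c = c1 ++ x2 ++ c2 ∧ c2 ++ t ++ c1 = x3 ++ x4 ++ x1) ∨
  (∃ t1 t2, t = t1 ++ x2 ++ t2 ∧ t2 ++ c ++ t1 = x3 ++ x4 ++ x1) ∨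
  (∃ c1 c2, c = c1 ++ x4 ++ c2 ∧ c2 ++ t ++ c1 = x1 ++ x2 ++ x3) ∨
  (∃ t1 t2, t = t1 ++ x4 ++ t2 ∧ t2 ++ c ++ t1 = x1 ++ x2 ++ x3) ∨
  (∃ v1 v2 u1 u2, x2 = v1 ++ v2 ∧ x4 = u1 ++ u2 ∧ c = v2 ++ x3 ++ u1 ∧ t = u2 ++ x1 ++ v1) ∨
  (∃ v1 v2 u1 u2, x2 = v1 ++ v2 ∧ x4 = u1 ++ u2 ∧ t = v2 ++ x3 ++ u1 ∧ c = u2 ++ x1 ++ v1)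

theorem LL.swap {c t x1 x2 x3 x4 : Wd α} (h : LL c t x1 x2 x3 x4) : LL t c x1 x2 x3 x4 := by
  unfold LL at *
  rcases h with h | h | h | h | h | h
  · exact Or.inr (Or.inl h)
  · exact Or.inl h
  · exact Or.inr (Or.inr (Or.inr (Or.inl h)))
  · exact Or.inr (Or.inr (Or.inl h))
  · exact Or.inr (Or.inr (Or.inr (Or.inr (Or.inr h))))
  · exact Or.inr (Or.inr (Or.inr (Or.inr (Or.inl h))))

theorem LL_core {y1 y2 y3 x1 x2 x3 x4 : Wd α} (h : x1 ++ (x2 ++ (x3 ++ x4)) = y1 ++ (y2 ++ y3)) :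
    LL y2 (y3 ++ y1) x1 x2 x3 x4 := by
  rcases List.append_eq_append_iff.1 h with ⟨p, h1, h2⟩ | ⟨p, h1, h2⟩
  · subst h1
    rcases List.append_eq_append_iff.1 h2 with ⟨r, h3, h4⟩ | ⟨r, h3, h4⟩
    · subst h3
      exact Or.inr (Or.inl ⟨y3 ++ x1, r, by simp, by
        have := congrArg (· ++ x1) h4
        simpa using this.symm⟩)
    · subst h3
      rcases List.append_eq_append_iff.1 h4 with ⟨z, h5, h6⟩ | ⟨z, h5, h6⟩
      · subst h5; subst h6
        exact Or.inr (Or.inr (Or.inr (Or.inl ⟨z ++ x3, x1 ++ p, by simp, by simp⟩))) 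
      · subst h5
        rcases List.append_eq_append_iff.1 h6 with ⟨z', h7, h8⟩ | ⟨z', h7, h8⟩
        · subst h7; subst h8
          exact Or.inr (Or.inr (Or.inr (Or.inr (Or.inl ⟨p, r, z', y3, by simp, by simp, by simp, by simp⟩))))
        · subst h7; subst h8
          exact Or.inr (Or.inr (Or.inr (Or.inl ⟨z', x1 ++ p, by simp, by simp⟩)))
  · subst h1
    rcases List.append_eq_append_iff.1 h2 with ⟨r, h3, h4⟩ | ⟨r, h3, h4⟩
    · subst h3; subst h4
      exact Or.inr (Or.inl ⟨r, x3 ++ x4 ++ y1, by simp, by simp⟩)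
    · subst h3
      rcases List.append_eq_append_iff.1 h4 with ⟨z, h5, h6⟩ | ⟨z, h5, h6⟩
      · subst h5
        exact Or.inl ⟨p, z, by simp, by
          have := congrArg (· ++ (y1 ++ p)) h6
          simpa using this.symm⟩ 
      · subst h5; subst h6
        exact Or.inr (Or.inr (Or.inr (Or.inl ⟨z ++ x3, y1, by simp, by simp⟩)))

theorem LL_of {c t x1 x2 x3 x4 : Wd α} (h : (c ++ t) ~r (x1 ++ x2 ++ x3 ++ x4)) :
    LL c t x1 x2 x3 x4 := by
  obtain ⟨p, q, h1, h2⟩ := rot_iff.1 h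
  simp only [List.append_assoc] at h2
  rcases List.append_eq_append_iff.1 h1 with ⟨d, h3, h4⟩ | ⟨d, h3, h4⟩
  · subst h3; subst h4
    exact LL_core h2
  · subst h3; subst h4
    exact (LL_core (by simpa using h2)).swap

theorem Inv_comb (S : SC lam Rel) {T1 T2 : ℤ} {c1 c2 L : ℝ} {p : Wd α × Wd α} (hL : 0 < L)
    (hp : (p.1.length : ℝ) + p.2.length = L) (h1 : Inv lam T1 c1 L) (h2 : Inv lam T2 c2 L) :
    Inv lam (T1 + phi lam p + T2) (c1 + p.1.length + c2) L := by
  have hge := phi_ge (lam := lam) p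
  have three : ∀ {T : ℤ} {c : ℝ}, Inv lam T c L → 3 ≤ T := by
    rintro T c (h | h | ⟨M, h, h', -⟩) <;> omega
  have t1 := three h1
  have t2 := three h2
  rcases h1 with h1 | h1 | ⟨M1, h1, h1', h1''⟩
  · left; omega
  · left; omega
  rcases h2 with h2 | h2 | ⟨M2, h2, h2', h2''⟩
  · left; omega
  · left; omega
  have hl := S.pos
  have hlL : 0 < lam * L := by positivity
  by_cases hg : (p.1.length : ℝ) < lam * L
  · refine Or.inr (Or.inr ⟨M1 + M2 + 1, by omega, by push_cast; omega, ?_⟩)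
    push_cast
    nlinarith
  · have h0 : 0 ≤ phi lam p := by
      unfold phi
      rw [hp]
      split_ifs <;> norm_num
    by_cases hc : c1 + p.1.length + c2 ≤ (1 - lam) * L
    · exact Or.inr (Or.inl ⟨by omega, hc⟩)
    · left
      by_cases hM : 3 ≤ M1 + M2
      · omega
      · have e1 : M1 = 1 := by omega
        have e2 : M2 = 1 := by omega
        subst e1; subst e2
        have : 1 ≤ phi lam p := by
          unfold phi
          rw [hp]
          have : (p.2.length : ℝ) < 3 * lam * L := by
            push_cast at h1'' h2''
            nlinarith
          split_ifs <;> norm_num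
        push_cast at *
        omega

theorem CC_c (S : SC lam Rel) {n m1 m2 : ℕ} (hm : m1 + m2 = n) (k1 : 1 ≤ m1) (k2 : 1 ≤ m2)
    (C1 : CC lam Rel m1) (C2 : CC lam Rel m2) {s g v1 v2 u1 u2 : Wd α}
    (cv : CR (v1 ++ v2)) (cu : CR (u1 ++ u2)) (ev : Exact Rel m1 (mk (v1 ++ v2)))
    (eu : Exact Rel m2 (mk (u1 ++ u2)))
    (hr : Rel (s ++ invRev (v2 ++ invRev g ++ u1)))
    (hlb : ∀ m, Ar Rel m (mk s * mk (u2 ++ g ++ v1)) → n + 1 ≤ m)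
    (hns : ∀ t1 x t2 m1 m2, u2 ++ g ++ v1 = t1 ++ x ++ t2 → mk x ≠ 1 → Ar Rel m1 (mk x) →
      Ar Rel m2 (mk (v2 ++ invRev g ++ u1) * mk t1 * mk t2) → n < m1 + m2) :
    ∃ segs, cat segs = u2 ++ g ++ v1 ∧ Ev Rel n (mk s) segs 1 ∧
      Inv lam (wt lam segs) (v2 ++ invRev g ++ u1).length (s ++ invRev (v2 ++ invRev g ++ u1)).length := by
  have hr1 : Rel ((s ++ invRev u1 ++ g) ++ invRev v2) := by
    simpa [invRev_append, invRev_invRev] using hr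
  have hr2 : Rel ((g ++ invRev v2 ++ s) ++ invRev u1) := by
    refine S.rotr hr1 ?_
    simpa using rot_comm (s ++ invRev u1) (g ++ invRev v2)
  obtain ⟨sv, a1, a2, a3⟩ := C1 v2 v1 (s ++ invRev u1 ++ g) (cv.rot (rot_comm _ _)) (ev.rot (rot_comm _ _)) k1 hr1
    (by
      intro m h
      have h1 := (eu.1.conj (mk s * (mk u1)⁻¹)).mul h
      have := hlb (m2 + m) (h1.tr 1 (by simp only [mk_app, mk_inv]; group))
      omega)
    (by
      rintro t1 x t2 a b rfl hx ha hb
      have h1 := (eu.1.conj (mk v2 * (mk g)⁻¹)).mul hb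
      have := hns (u2 ++ g ++ t1) x t2 a (m2 + b) (by simp) hx ha (h1.tr 1 (by simp only [mk_app, mk_inv]; group))
      omega)
  obtain ⟨su, b1, b2, b3⟩ := C2 u1 u2 (g ++ invRev v2 ++ s) cu eu k2 hr2
    (by
      intro m h
      have h1 := h.mul (ev.1.conj (mk g))
      have := hlb (m + m1) (h1.tr (mk v2 * (mk g)⁻¹) (by simp only [mk_app, mk_inv]; group))
      omega)
    (by
      rintro t1 x t2 a b rfl hx ha hb
      have h1 := (ev.1.conj (mk g)).mul hb
      have := hns t1 x (t2 ++ g ++ v1) a (m1 + b) (by simp) hx ha (h1.tr ((mk v1)⁻¹ * (mk g)⁻¹) (by simp only [mk_app, mk_inv]; group))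
      omega)
  have hr3 : Rel (g ++ (invRev v2 ++ s ++ invRev u1)) := by simpa using hr2
  refine ⟨su ++ [(g, invRev v2 ++ s ++ invRev u1)] ++ sv, by simp [a1, b1], ?_, ?_⟩
  · rw [Ev_append, Ev_append]
    refine ⟨⟨b2.map fun x hx => ?_, hr3, ?_, trivial⟩, a2.map fun x hx => ?_⟩
    · have h1 := hx.mul (ev.1.conj (mk g))
      rw [show m2 + m1 = n by omega] at h1
      refine h1.tr (mk v2 * (mk g)⁻¹) ?_
      simp only [mk_app, mk_inv, cat_cons, cat_nil, mk_nil', a1]; group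
    · have h1 := (eu.1.conj (mk s * (mk u1)⁻¹)).mul (ev.1.conj (mk v1)⁻¹)
      rw [show m2 + m1 = n by omega] at h1
      refine h1.tr 1 ?_
      simp only [mk_app, mk_inv, cat_cons, cat_nil, mk_nil', a1, b1]; group
    · have h1 := (eu.1.conj (mk s * (mk u1)⁻¹)).mul hx
      rw [show m2 + m1 = n by omega] at h1
      refine h1.tr 1 ?_
      simp only [mk_app, mk_inv, cat_cons, cat_append, cat_nil, mk_nil', b1]; group
  · have e1 : ((s ++ invRev u1 ++ g ++ invRev v2).length : ℝ) = (s ++ invRev (v2 ++ invRev g ++ u1)).length := by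
      simp [invRev_append]; try ring
    have e2 : ((g ++ invRev v2 ++ s ++ invRev u1).length : ℝ) = (s ++ invRev (v2 ++ invRev g ++ u1)).length := by
      simp [invRev_append]; try ring
    rw [e1] at a3
    rw [e2] at b3
    have h0 : (0 : ℝ) < (s ++ invRev (v2 ++ invRev g ++ u1)).length := by
      have := List.length_pos_iff.2 (S.ne_nil hr)
      exact_mod_cast this
    have := Inv_comb S (p := (g, invRev v2 ++ s ++ invRev u1)) h0 (by simp [invRev_append]; ring) b3 a3
    convert this using 1
    · simp; ring
    · simp; ring

theorem CC_of (S : SC lam Rel) {n : ℕ} (hA : AA lam Rel n) (hC : ∀ m < n, CC lam Rel m)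
    (hS : ∀ m < n, SH lam Rel m) : CC lam Rel n := by
  intro c t s hcr hex hn hr hlb hns
  by_cases hsp : Split Rel n (c ++ t)
  · obtain ⟨g, v, u, m1, m2, hrot, cv, cu, ev, eu, k1, k2, hm⟩ := splitMax hcr hex hsp
    have hcs : Rel (c ++ invRev s) := by
      have := S.inv hr
      rwa [invRev_append, invRev_invRev] at this
    have vne := ev.ne_one k1
    have une := eu.ne_one k2
    rcases LL_of hrot with ⟨c1, c2, h1, h2⟩ | ⟨t1, t2, h1, h2⟩ | ⟨c1, c2, h1, h2⟩ | ⟨t1, t2, h1, h2⟩ |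
      ⟨v1, v2, u1, u2, rfl, rfl, rfl, rfl⟩ | ⟨v1, v2, u1, u2, rfl, rfl, rfl, rfl⟩
    · exfalso
      have h3 := inside S (hS m1 (by omega)) k1 cv.red ev (s := c2 ++ invRev s ++ c1) (by
        rw [h1] at hcs
        refine S.rotr hcs ?_
        simpa using rot_comm c1 (v ++ c2 ++ invRev s))
      have h4 := congrArg mk h2
      have h5 := (h3.inv S).mul (eu.1.conj (mk g)⁻¹)
      have := hlb _ (h5.tr (mk c1) (by
        simp only [mk_app, mk_inv] at h4 ⊢
        have : (mk g)⁻¹ * mk u * (mk g)⁻¹⁻¹ = mk c2 * mk t * mk c1 := by rw [h4]; group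
        rw [this]; group))
      omega
    · exfalso
      have h4 := congrArg mk h2
      have := hns t1 v t2 m1 m2 h1 vne ev.1 (eu.1.tr ((mk t2)⁻¹ * (mk g)⁻¹) (by
        simp only [mk_app, mk_inv] at h4 ⊢
        have : mk u = mk g * (mk t2 * mk c * mk t1) * (mk g)⁻¹ := by rw [h4]; group
        rw [this]; group))
      omega
    · exfalso
      have h3 := inside S (hS m2 (by omega)) k2 cu.red eu (s := c2 ++ invRev s ++ c1) (by
        rw [h1] at hcs
        refine S.rotr hcs ?_
        simpa using rot_comm c1 (u ++ c2 ++ invRev s))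
      have h4 := congrArg mk h2
      have h5 := (h3.inv S).mul (ev.1.conj (mk g))
      have := hlb _ (h5.tr (mk c1) (by
        simp only [mk_app, mk_inv] at h4 ⊢
        rw [← h4]; group))
      omega
    · exfalso
      have h4 := congrArg mk h2
      have := hns t1 u t2 m2 m1 h1 une eu.1 (ev.1.tr ((mk t2)⁻¹ * (mk g)) (by
        simp only [mk_app, mk_inv] at h4 ⊢
        have : mk v = (mk g)⁻¹ * (mk t2 * mk c * mk t1) * (mk g) := by rw [h4]; group
        rw [this]; group))
      omega
    · exact CC_c S hm k1 k2 (hC m1 (by omega)) (hC m2 (by omega)) cv cu ev eu hr hlb hns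
    · have := CC_c S (g := invRev g) (show m2 + m1 = n by omega) k2 k1 (hC m2 (by omega)) (hC m1 (by omega)) cu cv eu ev
        (s := s) (by simpa [invRev_invRev] using hr) hlb (by simpa only [invRev_invRev] using hns)
      simpa only [invRev_invRev] using this
  · exact CC_unsplit S hn hr hlb (hA _ hcr hex hn hsp)

theorem AA_of (S : SC lam Rel) {n : ℕ} (hC : ∀ m < n, CC lam Rel m)
    (hS : ∀ m < n, SH lam Rel m) : AA lam Rel n := by
  intro W hW hex hn hsp
  have hWne : W ≠ [] := by
    rintro rfl
    exact hex.ne_one hn rfl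
  obtain ⟨m, rfl⟩ : ∃ m, n = m + 1 := ⟨n - 1, by omega⟩
  rcases Nat.eq_zero_or_pos m with rfl | hm
  · left
    have h1 := hex.1
    generalize hz : mk W = z at h1
    cases h1 with
    | one => exact absurd hz (hex.ne_one hn)
    | step _ y h L hL hy =>
      have hy1 := hy.zero
      subst hy1
      have := conj_rot (S.cr hL) hW (S.ne_nil hL) h (by rw [hz]; simp)
      exact S.rotr hL this
  · right
    rcases E_lemma S hm (hS m (by omega)) hW hex with h | ⟨s, t, q, h1, h2, h3, h4⟩
    · exact absurd h hsp
    · have hst := hex.rot h1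
      have hlb : ∀ k, Ar Rel k (mk s * mk t) → m + 1 ≤ k := by
        intro k hk; exact hst.2 k (by rwa [mk_app])
      obtain ⟨segs, a1, a2, a3⟩ := hC m (by omega) (invRev q) t s h4
        ⟨by rwa [mk_app, mk_inv], fun k hk => by
          have := hlb (1 + k) (((Ar.rel h2).mul hk).tr 1 (by simp only [mk_app, mk_inv]; group))
          omega⟩ hm (by rwa [invRev_invRev]) hlb
        (by
          rintro t1 x t2 m1 m2 rfl hx k1 k2
          by_contra hlt
          have hu : Ar Rel (m2 + 1) (mk (t2 ++ s ++ t1)) := by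
            rw [Nat.add_comm]
            refine ((Ar.rel h2).mul k2).tr (mk t2) ?_
            simp only [mk_app, mk_inv]; group
          refine hsp ⟨[], x, t2 ++ s ++ t1, m1, m2 + 1, ?_, hx, ?_, k1, hu, by omega⟩
          · refine h1.trans ?_
            simpa using rot_comm (s ++ t1) (x ++ t2)
          · intro h
            have := hlb m1 (k1.tr (mk t2)⁻¹ (by
              simp only [mk_app] at h ⊢
              have e : mk s * mk t1 = (mk t2)⁻¹ := by
                rw [eq_inv_iff_mul_eq_one, ← inv_eq_iff_mul_eq_one, eq_comm, ← mul_eq_one_iff_eq_inv, ← mul_assoc]; exact h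
              rw [← mul_assoc, ← mul_assoc, e]; group))
            omega)
      rw [invRev_invRev] at a3
      refine ⟨(s, q) :: segs, by simpa [a1] using h1.symm, ⟨h2, ?_, ?_⟩, ?_⟩
      · simpa [a1] using h3
      · simpa using a2
      · rw [wt_cons]
        have g1 := phi_ge (lam := lam) (s, q)
        have hlam := S.pos
        have hsm := S.small
        have hL2 := S.L200 h2
        have hL3 : lam * ((s ++ q).length : ℝ) ≤ 1 / 100 * ((s ++ q).length : ℝ) := by gcongr
        have hL : ((s ++ q).length : ℝ) = s.length + q.length := by simp
        rw [hL] at a3 hL2 hL3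
        rw [invRev_length] at a3
        have zero : (q.length : ℝ) ≤ (1 - lam) * (s.length + q.length) → 0 ≤ phi lam (s, q) := by
          intro h
          unfold phi
          simp only
          split_ifs <;> first | (exfalso; linarith) | norm_num
        rcases a3 with h | ⟨h, h'⟩ | ⟨M, hM, h, h'⟩
        · omega
        · have := zero h'; omega
        · rcases Nat.lt_or_ge 4 M with h5 | h5
          · omega
          · interval_cases M
            · have : phi lam (s, q) = 3 := by
                unfold phi; rw [if_pos]; simp only; push_cast at h'; linarith
              push_cast at h; omega
            · have : 2 ≤ phi lam (s, q) := by
                unfold phi; simp only; push_cast at h'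
                split_ifs <;> norm_num
              push_cast at h; omega
            · have : 1 ≤ phi lam (s, q) := by
                unfold phi; simp only; push_cast at h'
                split_ifs <;> norm_num
              push_cast at h; omega
            · have := zero (by push_cast at h'; linarith)
              push_cast at h; omega

end SCG

set_option linter.unusedSectionVars false
set_option linter.unusedSimpArgs false
set_option linter.unusedVariables false

namespace SCG
open FreeGroup
variable {α : Type} [DecidableEq α] {lam : ℝ} {Rel : Wd α → Prop}

/-- large part of a relator -/
def Shell (c lam : ℝ) (Rel : Wd α → Prop) (a : Wd α) : Prop :=
  ∃ b, Rel (a ++ b) ∧ (b.length : ℝ) < c * lam * ((a ++ b).length : ℝ)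

theorem Shell.weak (S : SC lam Rel) {a : Wd α} (h : Shell 1 lam Rel a) : Shell 3 lam Rel a := by
  obtain ⟨b, h1, h2⟩ := h
  refine ⟨b, h1, ?_⟩
  have := S.L200 h1
  nlinarith

theorem Shell_phi (S : SC lam Rel) {p : Wd α × Wd α} (hr : Rel (p.1 ++ p.2)) (h : 1 ≤ phi lam p) :
    Shell 3 lam Rel p.1 := by
  refine ⟨p.2, hr, ?_⟩
  have := phi_pos S h
  simpa using this

theorem Shell_phi3 (S : SC lam Rel) {p : Wd α × Wd α} (hr : Rel (p.1 ++ p.2)) (h : 3 ≤ phi lam p) :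
    Shell 1 lam Rel p.1 := by
  refine ⟨p.2, hr, ?_⟩
  have := phi_three h
  simpa using this

/-- conclusion of the linear Greendlinger lemma -/
def BlinC (lam : ℝ) (Rel : Wd α → Prop) (n : ℕ) (W : Wd α) : Prop :=
  (∃ x a y b, W = x ++ a ++ y ∧ Rel (a ++ b) ∧ (b.length : ℝ) < 1 * lam * ((a ++ b).length : ℝ) ∧
    Ar Rel (n - 1) (mk x * (mk b)⁻¹ * mk y)) ∨
  (∃ x a y a' z b, W = x ++ a ++ y ++ a' ++ z ∧ Rel (a ++ b) ∧
    (b.length : ℝ) < 3 * lam * ((a ++ b).length : ℝ) ∧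
    Ar Rel (n - 1) (mk x * (mk b)⁻¹ * mk (y ++ a' ++ z)) ∧ Shell 3 lam Rel a')

def Blin (lam : ℝ) (Rel : Wd α → Prop) (n : ℕ) : Prop :=
  ∀ W : Wd α, CR W → Exact Rel n (mk W) → 1 ≤ n → BlinC lam Rel n W

theorem BlinC_of_Dec (S : SC lam Rel) {n : ℕ} {W : Wd α} (h : Dec lam Rel n W) : BlinC lam Rel n W := by
  rcases h with h | ⟨segs, h1, h2, h3⟩
  · left
    refine ⟨[], W, [], [], by simp, by simpa using h, ?_, ?_⟩
    · have := S.L200 h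
      simp; linarith
    · simpa [mk_nil'] using Ar.one (Rel := Rel) (n - 1)
  · have hne : segs ≠ [] := by rintro rfl; simp at h3
    obtain ⟨a, b, v, l, e1, e2, e3⟩ := cutLemma (lam := lam) hne h1 h2
    obtain ⟨f1, f2, f3⟩ := e2
    have hD : Ev Rel (n - 1) 1 ((b, v ++ a) :: (l ++ [(a, b ++ v)])) 1 := by
      refine ⟨?_, ?_, ?_⟩
      · refine S.rotr f1 ?_
        simpa using rot_comm a (b ++ v)
      · refine f2.tr (mk a)⁻¹ ?_
        simp only [mk_app, cat_append, cat_cons, cat_nil, mk_nil']; group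
      · rw [Ev_append]
        refine ⟨f3.map fun x hx => ?_, ?_, ?_, trivial⟩
        · refine hx.tr (mk a)⁻¹ ?_
          simp only [mk_app, cat_append, cat_cons, cat_nil, mk_nil']; group
        · simpa using f1
        · refine f2.tr (mk b * mk v) ?_
          simp only [mk_app, cat_append, cat_cons, cat_nil, mk_nil']; group
    have hL := S.L200 f1
    have hc := phi_cut2 S (p := (a ++ b, v)) (q := (b, v ++ a)) (q' := (a, b ++ v)) (d := 0)
      (by simp; ring) (by simp; ring) (by simp at hL ⊢; linarith) (by simp; ring)
    have hw : 3 ≤ wt lam ((b, v ++ a) :: (l ++ [(a, b ++ v)])) := by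
      simp at e3 ⊢
      omega
    have hcat : cat ((b, v ++ a) :: (l ++ [(a, b ++ v)])) = W := by simpa using e1
    rcases wt_three hw with ⟨l1, p, l2, e, hp⟩ | ⟨l1, p, l2, q, l3, e, hp, hq⟩
    · left
      rw [e] at hD hcat
      refine ⟨cat l1, p.1, cat l2, p.2, by simp [← hcat], hD.rel, by simpa using phi_three hp, ?_⟩
      simpa using hD.ar
    · right
      rw [e] at hD hcat
      refine ⟨cat l1, p.1, cat l2, q.1, cat l3, p.2, by simp [← hcat], ?_, by simpa using phi_pos S hp, ?_, ?_⟩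
      · exact Ev.rel (l1 := l1) (l2 := l2 ++ q :: l3) (by simpa using hD)
      · have := Ev.ar (l1 := l1) (l2 := l2 ++ q :: l3) (x := p) (by simpa using hD)
        simpa using this
      · exact Shell_phi S hD.rel hq

theorem arc {W x1 x2 x3 x4 : Wd α} (h : W ~r (x1 ++ x2 ++ x3 ++ x4)) (h2 : x2 ≠ []) (h4 : x4 ≠ []) :
    (∃ y z, W = y ++ x2 ++ z ∧ z ++ y = x3 ++ x4 ++ x1) ∨
    (∃ y z, W = y ++ x4 ++ z ∧ z ++ y = x1 ++ x2 ++ x3) := by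
  have h' : (W ++ []) ~r (x1 ++ x2 ++ x3 ++ x4) := by simpa using h
  rcases LL_of h' with ⟨y, z, e, e'⟩ | ⟨y, z, e, e'⟩ | ⟨y, z, e, e'⟩ | ⟨y, z, e, e'⟩ |
    ⟨v1, v2, u1, u2, e1, e2, e3, e4⟩ | ⟨v1, v2, u1, u2, e1, e2, e3, e4⟩
  · exact Or.inl ⟨y, z, e, by simpa using e'⟩
  · simp at e; exact absurd e.2.1 h2
  · exact Or.inr ⟨y, z, e, by simpa using e'⟩
  · simp at e; exact absurd e.2.1 h4
  · simp at e4
    obtain ⟨rfl, rfl, rfl⟩ := e4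
    left
    exact ⟨[], x3 ++ u1, by simp [e3, e1], by simp [e2]⟩
  · simp at e3
    obtain ⟨rfl, rfl, rfl⟩ := e3
    left
    exact ⟨u2 ++ x1, [], by simp [e4, e1], by simp [e2]⟩

theorem BlinC_ext {m1 m2 : ℕ} (h1 : 1 ≤ m1) {y v z : Wd α} (h : BlinC lam Rel m1 v)
    (h2 : Ar Rel m2 (mk z * mk y)) : BlinC lam Rel (m1 + m2) (y ++ v ++ z) := by
  rcases h with ⟨x, a, t, b, rfl, hr, hl, ha⟩ | ⟨x, a, t, a', t', b, rfl, hr, hl, ha, hs⟩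
  · left
    refine ⟨y ++ x, a, t ++ z, b, by simp, hr, hl, ?_⟩
    have := ha.mul h2
    rw [show m1 - 1 + m2 = m1 + m2 - 1 by omega] at this
    refine this.tr (mk y) ?_
    simp only [mk_app]; group
  · right
    refine ⟨y ++ x, a, t, a', t' ++ z, b, by simp, hr, hl, ?_, hs⟩
    have := ha.mul h2
    rw [show m1 - 1 + m2 = m1 + m2 - 1 by omega] at this
    refine this.tr (mk y) ?_
    simp only [mk_app]; group

theorem Blin_of (S : SC lam Rel) {n : ℕ} (hA : AA lam Rel n) (hB : ∀ m < n, Blin lam Rel m) :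
    Blin lam Rel n := by
  intro W hW hex hn
  by_cases hsp : Split Rel n W
  · obtain ⟨g, v, u, m1, m2, hrot, cv, cu, ev, eu, k1, k2, hm⟩ := splitMax hW hex hsp
    have vne : v ≠ [] := by rintro rfl; exact ev.ne_one k1 rfl
    have une : u ≠ [] := by rintro rfl; exact eu.ne_one k2 rfl
    rcases arc hrot vne une with ⟨y, z, rfl, e⟩ | ⟨y, z, rfl, e⟩
    · have h1 := BlinC_ext (m2 := m2) k1 (y := y) (z := z) (hB m1 (by omega) v cv ev k1) (by
        rw [← mk_app, e]
        refine eu.1.tr (mk g)⁻¹ ?_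
        simp only [mk_app, mk_inv]; group)
      rwa [hm] at h1
    · have h1 := BlinC_ext (m2 := m1) k2 (y := y) (z := z) (hB m2 (by omega) u cu eu k2) (by
        rw [← mk_app, e]
        refine ev.1.tr (mk g) ?_
        simp only [mk_app, mk_inv])
      rwa [add_comm, hm] at h1
  · exact BlinC_of_Dec S (hA W hW hex hn hsp)

theorem SH_of (S : SC lam Rel) {n : ℕ} (hB : Blin lam Rel n) : SH lam Rel n := by
  intro Y hY hex hn
  obtain ⟨k, c, rfl, hc⟩ := cycRed _ Y le_rfl hY
  have hexc : Exact Rel n (mk c) := hex.conj (mk k)⁻¹ (by simp only [mk_app, mk_inv]; group)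
  rcases hB c hc hexc hn with ⟨x, a, t, b, rfl, hr, hl, ha⟩ | ⟨x, a, t, a', t', b, rfl, hr, hl, ha, hs⟩
  · refine ⟨k ++ x, a, t ++ invRev k, b, by simp, hr, ?_, ?_⟩
    · have := S.L200 hr
      linarith
    · refine ha.tr (mk k) ?_
      simp only [mk_app, mk_inv]; group
  · refine ⟨k ++ x, a, t ++ a' ++ t' ++ invRev k, b, by simp, hr, hl, ?_⟩
    refine ha.tr (mk k) ?_
    simp only [mk_app, mk_inv]; group

theorem mainInd (S : SC lam Rel) : ∀ n, AA lam Rel n ∧ Blin lam Rel n ∧ SH lam Rel n ∧ CC lam Rel n := by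
  intro n
  induction n using Nat.strong_induction_on with
  | _ n ih =>
    have hA : AA lam Rel n := AA_of S (fun m hm => (ih m hm).2.2.2) (fun m hm => (ih m hm).2.2.1)
    have hB : Blin lam Rel n := Blin_of S hA (fun m hm => (ih m hm).2.1)
    exact ⟨hA, hB, SH_of S hB, CC_of S hA (fun m hm => (ih m hm).2.2.2) (fun m hm => (ih m hm).2.2.1)⟩

theorem wt_six {l : List (Wd α × Wd α)} (h : 6 ≤ wt lam l) :
    (∃ p l1 q l2 l', l = l' ∧ l' ~r (p :: l1 ++ q :: l2) ∧ 3 ≤ phi lam p ∧ 3 ≤ phi lam q) ∨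
    (∃ p l1 q l2 r l3, l ~r (p :: l1 ++ q :: l2 ++ r :: l3) ∧ 1 ≤ phi lam p ∧ 1 ≤ phi lam q ∧ 1 ≤ phi lam r) := by
  obtain ⟨k1, p, k2, rfl, hp⟩ := wt_pos (show 1 ≤ wt lam l by omega)
  have hrot : (k1 ++ p :: k2) ~r (p :: (k2 ++ k1)) := by
    have := (List.isRotated_append : (k1 ++ p :: k2) ~r _)
    simpa using this
  have h3 : 3 ≤ wt lam (k2 ++ k1) := by
    have := phi_le (lam := lam) p
    simp at h ⊢; omega
  have h6 : 6 ≤ phi lam p + wt lam (k2 ++ k1) := by simp at h ⊢; omega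
  generalize k2 ++ k1 = k at *
  rcases wt_three h3 with ⟨l1, q, l2, rfl, hq⟩ | ⟨l1, q, l2, r, l3, rfl, hq, hr⟩
  · by_cases hp3 : 3 ≤ phi lam p
    · exact Or.inl ⟨p, l1, q, l2, _, rfl, hrot, hp3, hq⟩
    · have := phi_le (lam := lam) q
      simp at h6
      right
      by_cases h1 : 1 ≤ wt lam l1
      · obtain ⟨m1, r, m2, rfl, hr⟩ := wt_pos h1
        exact ⟨p, m1, r, m2, q, l2, by simpa using hrot, hp, hr, by omega⟩
      · obtain ⟨m1, r, m2, rfl, hr⟩ := wt_pos (show 1 ≤ wt lam l2 by omega)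
        exact ⟨p, l1, q, m1, r, m2, by simpa using hrot, hp, by omega, hr⟩
  · exact Or.inr ⟨p, l1, q, l2, r, l3, by simpa using hrot, hp, hq, hr⟩

theorem cat_rot {l m : List (Wd α × Wd α)} (h : l ~r m) : cat l ~r cat m := by
  obtain ⟨n, rfl⟩ := h
  rw [List.rotate_eq_drop_append_take_mod]
  have := rot_comm (cat (l.take (n % l.length))) (cat (l.drop (n % l.length)))
  rwa [← cat_append, ← cat_append, List.take_append_drop] at this

theorem Ev.rot' {n : ℕ} {l m : List (Wd α × Wd α)} (hr : l ~r m) (h : Ev Rel n 1 l 1) : Ev Rel n 1 m 1 := by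
  obtain ⟨k, rfl⟩ := hr
  rw [List.rotate_eq_drop_append_take_mod]
  apply Ev.rot
  rwa [List.take_append_drop]

theorem Bcyc (S : SC lam Rel) {n : ℕ} {W : Wd α} (hW : CR W) (hex : Exact Rel n (mk W)) (hn : 1 ≤ n) :
    Rel W ∨ (∃ a y a' z, W ~r (a ++ y ++ a' ++ z) ∧ Shell 1 lam Rel a ∧ Shell 1 lam Rel a') ∨
    (∃ a y a' y' a'' z, W ~r (a ++ y ++ a' ++ y' ++ a'' ++ z) ∧ Shell 3 lam Rel a ∧ Shell 3 lam Rel a' ∧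
      Shell 3 lam Rel a'') := by
  by_cases hsp : Split Rel n W
  · right
    obtain ⟨g, v, u, m1, m2, hrot, cv, cu, ev, eu, k1, k2, hm⟩ := splitMax hW hex hsp
    rcases (mainInd S m1).2.1 v cv ev k1 with ⟨x, a, t, b, rfl, hr, hl, ha⟩ | ⟨x, a, t, a', t', b, rfl, hr, hl, ha, hs⟩ <;>
    rcases (mainInd S m2).2.1 u cu eu k2 with ⟨p, c, q, d, rfl, kr, kl, kc⟩ | ⟨p, c, q, c', q', d, rfl, kr, kl, kc, ks⟩
    · left
      refine ⟨a, t ++ invRev g ++ p, c, q ++ g ++ x, hrot.trans ?_, ⟨b, hr, hl⟩, ⟨d, kr, kl⟩⟩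
      simpa using rot_comm (g ++ x) (a ++ t ++ invRev g ++ p ++ c ++ q)
    · right
      refine ⟨a, t ++ invRev g ++ p, c, q, c', q' ++ g ++ x, hrot.trans ?_, Shell.weak S ⟨b, hr, hl⟩, ⟨d, kr, kl⟩, ks⟩
      simpa using rot_comm (g ++ x) (a ++ t ++ invRev g ++ p ++ c ++ q ++ c' ++ q')
    · right
      refine ⟨a, t, a', t' ++ invRev g ++ p, c, q ++ g ++ x, hrot.trans ?_, ⟨b, hr, hl⟩, hs, Shell.weak S ⟨d, kr, kl⟩⟩
      simpa using rot_comm (g ++ x) (a ++ t ++ a' ++ t' ++ invRev g ++ p ++ c ++ q)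
    · right
      refine ⟨a, t, a', t' ++ invRev g ++ p, c, q ++ c' ++ q' ++ g ++ x, hrot.trans ?_, ⟨b, hr, hl⟩, hs, ⟨d, kr, kl⟩⟩
      simpa using rot_comm (g ++ x) (a ++ t ++ a' ++ t' ++ invRev g ++ p ++ c ++ q ++ c' ++ q')
  · rcases (mainInd S n).1 W hW hex hn hsp with h | ⟨segs, h1, h2, h3⟩
    · exact Or.inl h
    · right
      rcases wt_six h3 with ⟨p, l1, q, l2, _, rfl, hr, hp, hq⟩ | ⟨p, l1, q, l2, r, l3, hr, hp, hq, hr'⟩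
      · left
        have he := Ev.rot' hr h2
        refine ⟨p.1, cat l1, q.1, cat l2, h1.symm.trans ?_, Shell_phi3 S he.1 hp, ?_⟩
        · simpa using cat_rot hr
        · exact Shell_phi3 S he.rel hq
      · right
        have he := Ev.rot' hr h2
        refine ⟨p.1, cat l1, q.1, cat l2, r.1, cat l3, h1.symm.trans ?_, Shell_phi S he.1 hp, ?_, ?_⟩
        · simpa using cat_rot hr
        · exact Shell_phi S (Ev.rel (l1 := p :: l1) (l2 := l2 ++ r :: l3) (by simpa using he)) hq
        · exact Shell_phi S he.rel hr'

end SCG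

set_option linter.unusedSectionVars false
set_option linter.unusedSimpArgs false
set_option linter.unusedVariables false

namespace SCG
open FreeGroup
variable {α : Type} [DecidableEq α] {lam : ℝ} {Rel : Wd α → Prop}

/-- trivial in the quotient -/
def N (Rel : Wd α → Prop) (x : FreeGroup α) : Prop := ∃ n, Ar Rel n x

theorem N.mul {x y : FreeGroup α} (h : N Rel x) (h' : N Rel y) : N Rel (x * y) := by
  obtain ⟨n, h⟩ := h
  obtain ⟨m, h'⟩ := h'
  exact ⟨_, h.mul h'⟩

theorem N.tr {x y : FreeGroup α} (h : N Rel x) (g : FreeGroup α) (e : y = g * x * g⁻¹) : N Rel y := by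
  obtain ⟨n, h⟩ := h
  exact ⟨n, h.tr g e⟩

theorem N.inv (S : SC lam Rel) {x : FreeGroup α} (h : N Rel x) : N Rel x⁻¹ := by
  obtain ⟨n, h⟩ := h
  exact ⟨n, h.inv S⟩

theorem N.rel {L : Wd α} (h : Rel L) : N Rel (mk L) := ⟨1, Ar.rel h⟩

theorem no_inv (S : SC lam Rel) {L : Wd α} (h : Rel L) (hr : L ~r invRev L) : False := by
  obtain ⟨a, b, e, e'⟩ := rot_iff.1 hr
  subst e
  rw [invRev_append] at e'
  have h1 := List.append_inj e' (by simp)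
  have key : ∀ c : Wd α, invRev c = c → mk c = 1 := by
    intro c hc
    have h2 : (mk c) ^ 2 = 1 := by
      have : mk c = (mk c)⁻¹ := by rw [← mk_inv, hc]
      rw [pow_two]
      nth_rewrite 2 [this]
      group
    exact (pow_eq_one_iff_left (by norm_num)).1 h2
  have ha := key a h1.2
  have hb := key b h1.1
  exact S.mk_ne_one h (by rw [mk_app, ha, hb, one_mul])

/-- no long subword of a relator -/
def LR (lam : ℝ) (Rel : Wd α → Prop) (w0 : Wd α) : Prop :=
  ∀ x a y b, w0 ~r (x ++ a ++ y) → Rel (a ++ b) → ¬ (b.length : ℝ) < 3 * lam * ((a ++ b).length : ℝ)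

def Good (Rel : Wd α → Prop) (e0 : α × Bool) (w0 g w : Wd α) : Prop :=
  w0 ~r w ∧ N Rel (mk g * mk w * (mk g)⁻¹ * (gen e0)⁻¹)

def Mn (Rel : Wd α → Prop) (e0 : α × Bool) (w0 g w : Wd α) : Prop :=
  Good Rel e0 w0 g w ∧ ∀ g' w', Good Rel e0 w0 g' w' → g.length ≤ g'.length

theorem modN (S : SC lam Rel) {e0 : α × Bool} {g w g' w' k : FreeGroup α} (hk : N Rel k)
    (h : N Rel (g * w * g⁻¹ * (gen e0)⁻¹)) (e : g' * w' * g'⁻¹ = k * (g * w * g⁻¹) * k⁻¹) :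
    N Rel (g' * w' * g'⁻¹ * (gen e0)⁻¹) := by
  have := (hk.mul h).mul ((hk.inv S).tr (gen e0) rfl)
  refine this.tr 1 ?_
  rw [e]; group

theorem shellOf (S : SC lam Rel) {x : Wd α} (hx : Red x) (hne : x ≠ []) (h : N Rel (mk x)) :
    ∃ p a q b, x = p ++ a ++ q ∧ Rel (a ++ b) ∧ (b.length : ℝ) < 3 * lam * ((a ++ b).length : ℝ) := by
  obtain ⟨n, h⟩ := h
  obtain ⟨m, _, hm⟩ := exact_of h
  obtain ⟨p, a, q, b, h1, h2, h3, _⟩ := (mainInd S m).2.2.1 x hx hm (hm.pos (hx.ne_one hne))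
  exact ⟨p, a, q, b, h1, h2, h3⟩

theorem bar_inj {e f : α × Bool} (h : bar e = bar f) : e = f := by
  rw [← bar_bar e, h, bar_bar]

section
variable {e0 : α × Bool} {w0 g w : Wd α}

theorem Mn.lt (M : Mn Rel e0 w0 g w) {g' w' : Wd α} (h1 : w0 ~r w')
    (h2 : N Rel (mk g' * mk w' * (mk g')⁻¹ * (gen e0)⁻¹)) (h3 : g'.length < g.length) : False := by
  have := M.2 g' w' ⟨h1, h2⟩
  omega

theorem Mn.redg (M : Mn Rel e0 w0 g w) : Red g := by
  by_contra h
  refine M.lt (g' := (mk g).toWord) (w' := w) M.1.1 ?_ (short_of_not_red h)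
  rw [mk_toWord]; exact M.1.2

theorem Mn.wnil (M : Mn Rel e0 w0 g w) (h : w = []) : g = [] := by
  subst h
  by_contra hg
  refine M.lt (g' := []) (w' := []) M.1.1 ?_ (by simpa using List.length_pos_iff.2 hg)
  refine M.1.2.tr 1 ?_
  simp only [mk_nil']; group

theorem Mn.gnil (S : SC lam Rel) (hw0 : CR w0) (hne : w0 ≠ [e0]) (hlr : LR lam Rel w0)
    (M : Mn Rel e0 w0 g w) (hg : g = []) {w1 : Wd α} (h : w = w1 ++ [e0] ∨ w = e0 :: w1) : False := by
  subst hg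
  have h1 : N Rel (mk w1) := by
    rcases h with rfl | rfl
    · refine M.1.2.tr 1 ?_
      simp only [mk_nil', mk_app, mk_cons']; group
    · refine M.1.2.tr (gen e0)⁻¹ ?_
      simp only [mk_nil', mk_app, mk_cons']; group
  have hred : Red w1 := by
    have := hw0.redrot M.1.1
    rcases h with rfl | rfl
    · exact this.left
    · exact Red.right (a := [e0]) this
  by_cases h2 : w1 = []
  · subst h2
    have : w = [e0] := by rcases h with h | h <;> simpa using h
    subst this
    have := M.1.1
    rw [List.isRotated_singleton_iff] at this
    exact hne this
  · obtain ⟨p, a, q, b, rfl, h3, h4⟩ := shellOf S hred h2 h1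
    rcases h with rfl | rfl
    · exact hlr p a (q ++ [e0]) b (by simpa using M.1.1) h3 h4
    · exact hlr (e0 :: p) a q b (by simpa using M.1.1) h3 h4

theorem Mn.cr (S : SC lam Rel) (hw0 : CR w0) (hne : w0 ≠ [e0]) (hlr : LR lam Rel w0)
    (M : Mn Rel e0 w0 g w) : CR (g ++ (w ++ (invRev g ++ [bar e0]))) := by
  have hwr := hw0.redrot M.1.1
  apply CR_of
  · apply Red_append M.redg
    · apply Red_append hwr
      · apply Red_append M.redg.inv
        · rintro a e b h
          have := congrArg List.length h
          simp at this
          omega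
        · intro e a' b' h1 h2
          simp at h2
          have h3 : g = bar e :: invRev a' := by
            rw [← invRev_invRev (L₁ := g), h1, invRev_append, invRev_single]; rfl
          rw [← h2.1] at h3
          refine M.lt (g' := invRev a') (w' := w) M.1.1 ?_ (by rw [h3]; simp)
          refine M.1.2.tr (gen e0) ?_
          rw [h3]
          simp only [mk_cons', mk_bar]; group
      · intro e a' b' h1 h2
        rcases List.eq_nil_or_concat g with hg | ⟨g1, f, hg⟩
        · rw [hg] at h2
          simp at h2
          have := bar_inj h2.1
          subst this
          exact M.gnil S hw0 hne hlr hg (Or.inl h1)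
        · rw [List.concat_eq_append] at hg
          rw [hg, invRev_append, invRev_single] at h2
          simp at h2
          have := bar_inj h2.1
          subst this
          refine M.lt (g' := g1) (w' := f :: a') (M.1.1.trans ?_) ?_ (by rw [hg]; simp)
          · rw [h1]; exact rot_comm a' [f]
          · refine M.1.2.tr 1 ?_
            rw [hg, h1]
            simp only [mk_app, mk_cons', mk_nil']; group
    · intro e a' b' h1 h2
      rcases w with _ | ⟨f, w1⟩
      · have := M.wnil rfl
        rw [this] at h1; simp at h1
      · simp at h2
        obtain ⟨rfl, h2⟩ := h2
        refine M.lt (g' := a') (w' := w1 ++ [bar e]) (M.1.1.trans ?_) ?_ (by rw [h1]; simp)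
        · exact rot_comm [bar e] w1
        · refine M.1.2.tr 1 ?_
          rw [h1]
          simp only [mk_app, mk_cons', mk_nil', mk_bar]; group
  · intro e K h
    have h' : g ++ (w ++ (invRev g)) ++ [bar e0] = (e :: K) ++ [bar e] := by rw [← h]; simp
    have h2 := List.append_inj' h' rfl
    have h3 : e0 = e := bar_inj (by simpa using h2.2)
    subst h3
    rcases hg : g with _ | ⟨f, g1⟩
    · rw [hg] at h2
      simp at h2
      exact M.gnil S hw0 hne hlr hg (Or.inr h2)
    · rw [hg] at h2
      simp at h2
      obtain ⟨⟨rfl, h2⟩, -⟩ := h2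
      refine M.lt (g' := g1) (w' := w) M.1.1 ?_ (by rw [hg]; simp)
      refine M.1.2.tr (gen e0)⁻¹ ?_
      rw [hg]
      simp only [mk_cons', mk_bar]; group

theorem SC.facts (S : SC lam Rel) {L : Wd α} (h : Rel L) :
    2 < lam * (L.length : ℝ) ∧ lam * (L.length : ℝ) ≤ 1 / 100 * (L.length : ℝ) := by
  refine ⟨S.L200 h, ?_⟩
  gcongr; exact S.small

theorem Mn.shellg (S : SC lam Rel) (M : Mn Rel e0 w0 g w) {x a y b : Wd α} (h : g = x ++ a ++ y)
    (hr : Rel (a ++ b)) (hb : (b.length : ℝ) < 3 * lam * ((a ++ b).length : ℝ)) : False := by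
  obtain ⟨f1, f2⟩ := S.facts hr
  have hk : N Rel (mk x * (mk b)⁻¹ * (mk a)⁻¹ * (mk x)⁻¹) := by
    refine ((N.rel hr).inv S).tr (mk x) ?_
    simp only [mk_app]; group
  refine M.lt (g' := x ++ invRev b ++ y) (w' := w) M.1.1 (modN S hk M.1.2 ?_) ?_
  · rw [h]; simp only [mk_app, mk_inv]; group
  · rw [h]
    simp at f1 f2 hb ⊢
    have : (b.length : ℝ) < a.length := by nlinarith
    exact_mod_cast this

theorem piece_inv (S : SC lam Rel) {L c x y : Wd α} (h : Rel L) (h1 : L ~r (c ++ x))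
    (h2 : invRev L ~r (c ++ y)) : (c.length : ℝ) < lam * (L.length : ℝ) := by
  have e : (L.length : ℝ) = ((c ++ x).length : ℝ) := by rw [h1.perm.length_eq]
  rw [e]
  refine S.piece (S.rotr h h1) (S.rotr (S.inv h) h2) ?_
  rintro rfl
  exact no_inv S h (h1.trans h2.symm)

theorem Mn.straddle (S : SC lam Rel) (M : Mn Rel e0 w0 g w) {x p q y b : Wd α}
    (h1 : invRev g = x ++ p) (h2 : g = q ++ y)
    (hr : Rel (p ++ [bar e0] ++ q ++ b))
    (hb : (b.length : ℝ) < 3 * lam * ((p ++ [bar e0] ++ q ++ b).length : ℝ)) : False := by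
  obtain ⟨f1, f2⟩ := S.facts hr
  have h3 : g = invRev p ++ invRev x := by
    rw [← invRev_invRev (L₁ := g), h1]; simp [invRev_append]
  have hL : ((p ++ [bar e0] ++ q ++ b).length : ℝ) = p.length + 1 + q.length + b.length := by
    simp; ring
  have ri : ∀ c : Wd α, invRev (p ++ [bar e0] ++ q ++ b) = invRev b ++ invRev q ++ [e0] ++ invRev p := by
    intro c
    simp only [invRev_append, invRev_single, bar_bar, List.append_assoc]
  rcases List.append_eq_append_iff.1 (h2.symm.trans h3) with ⟨s, h4, h5⟩ | ⟨s, h4, h5⟩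
  · have hp := piece_inv S hr (c := q) (x := b ++ p ++ [bar e0]) (y := s ++ invRev b ++ invRev q ++ [e0])
      (by simpa using rot_comm (p ++ [bar e0]) (q ++ b))
      (by
        rw [ri []]
        have := rot_comm (invRev b ++ invRev q ++ [e0]) (invRev p)
        refine this.trans ?_
        rw [h4]
        simp [List.IsRotated.refl])
    have hk : N Rel (mk ([bar e0] ++ q ++ b ++ p)) := by
      refine (N.rel hr).tr (mk p)⁻¹ ?_
      simp only [mk_app]; group
    refine M.lt (g' := [bar e0] ++ q ++ b ++ invRev x) (w' := w) M.1.1 (modN S hk M.1.2 ?_) ?_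
    · rw [h3]; simp only [mk_app, mk_inv]; group
    · rw [h3]
      rw [hL] at f1 f2 hb hp
      have : (1 : ℝ) + q.length + b.length < p.length := by nlinarith
      have : 1 + q.length + b.length < p.length := by exact_mod_cast this
      simp; omega
  · have hp := piece_inv S hr (c := invRev p) (x := s ++ b ++ p ++ [bar e0]) (y := invRev b ++ invRev q ++ [e0])
      (by
        have := rot_comm (p ++ [bar e0]) (q ++ b)
        rw [List.append_assoc _ q b]
        refine this.trans ?_
        rw [h4]
        simp [List.IsRotated.refl])
      (by
        rw [ri []]
        have := rot_comm (invRev b ++ invRev q ++ [e0]) (invRev p)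
        exact this)
    have hk : N Rel (mk ([e0] ++ invRev p ++ invRev b ++ invRev q)) := by
      refine ((N.rel hr).inv S).tr (mk q * mk b) ?_
      simp only [mk_app, mk_inv, mk_cons', mk_nil', mk_bar]; group
    refine M.lt (g' := [e0] ++ invRev p ++ invRev b ++ y) (w' := w) M.1.1 (modN S hk M.1.2 ?_) ?_
    · rw [h2]; simp only [mk_app, mk_inv]; group
    · rw [h2]
      rw [hL] at f1 f2 hb hp
      rw [invRev_length] at hp
      have : (1 : ℝ) + p.length + b.length < q.length := by nlinarith
      have : 1 + p.length + b.length < q.length := by exact_mod_cast this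
      simp; omega

theorem Mn.shellI (S : SC lam Rel) (M : Mn Rel e0 w0 g w) {x a y b : Wd α}
    (h : invRev g ++ ([bar e0] ++ g) = x ++ a ++ y)
    (hr : Rel (a ++ b)) (hb : (b.length : ℝ) < 3 * lam * ((a ++ b).length : ℝ)) : False := by
  obtain ⟨f1, f2⟩ := S.facts hr
  have inner : ∀ x' y' : Wd α, invRev g = x' ++ a ++ y' → False := by
    intro x' y' h'
    refine M.shellg S (x := invRev y') (a := invRev a) (y := invRev x') (b := invRev b) ?_ ?_ ?_
    · rw [← invRev_invRev (L₁ := g), h']; simp [invRev_append]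
    · have := S.inv hr
      rw [invRev_append] at this
      exact S.rot this
    · simpa using hb
  rw [List.append_assoc] at h
  rcases List.append_eq_append_iff.1 h with ⟨p, h1, h2⟩ | ⟨p, h1, h2⟩
  · rcases p with _ | ⟨f, p⟩
    · rcases a with _ | ⟨f, q⟩
      · simp at f1 hb f2; linarith
      · simp at h2
        obtain ⟨rfl, h2⟩ := h2
        exact M.straddle S (x := invRev g) (p := []) (q := q) (y := y) (b := b) (by simp) h2
          (by simpa using hr) (by simpa using hb)
    · simp at h2
      exact M.shellg S (x := p) (a := a) (y := y) (by simp [h2.2]) hr hb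
  · rcases List.append_eq_append_iff.1 h2 with ⟨s, h3, h4⟩ | ⟨s, h3, h4⟩
    · exact inner x s (by rw [h1, h3]; simp)
    · rcases s with _ | ⟨f, q⟩
      · exact inner x [] (by rw [h1]; simp [h3])
      · simp at h4
        obtain ⟨rfl, h4⟩ := h4
        subst h3
        exact M.straddle S h1 h4 (by simpa using hr) (by simpa using hb)

theorem Mn.relW (S : SC lam Rel) (hlr : LR lam Rel w0) (M : Mn Rel e0 w0 g w)
    (hr : Rel (g ++ (w ++ (invRev g ++ [bar e0])))) : False := by
  obtain ⟨f1, f2⟩ := S.facts hr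
  have hp := piece_inv S hr (c := g) (x := w ++ (invRev g ++ [bar e0])) (y := invRev w ++ invRev g ++ [e0])
    (List.IsRotated.refl _) (by
      have := rot_comm [e0] (g ++ invRev w ++ invRev g)
      simpa [invRev_append, invRev_single, bar_bar] using this)
  have hr2 : Rel (w ++ (invRev g ++ [bar e0] ++ g)) := by
    simpa using S.rot hr
  refine hlr [] w [] _ (by simpa using M.1.1) hr2 ?_
  simp at f1 f2 hp ⊢
  nlinarith

theorem Mn.two (S : SC lam Rel) (hlr : LR lam Rel w0) (M : Mn Rel e0 w0 g w) {v1 v2 u1 u2 x1 x3 : Wd α}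
    (hv : Shell 1 lam Rel (v1 ++ v2)) (hu : Shell 1 lam Rel (u1 ++ u2))
    (h1 : w = v2 ++ x3 ++ u1) (h2 : invRev g ++ ([bar e0] ++ g) = u2 ++ x1 ++ v1) : False := by
  have hlen : v1.length ≤ g.length ∨ u2.length ≤ g.length := by
    have := congrArg List.length h2
    simp at this
    omega
  rcases hlen with hl | hl
  · obtain ⟨b, hr, hb⟩ := hv
    obtain ⟨f1, f2⟩ := S.facts hr
    obtain ⟨g0, hg⟩ : ∃ g0, g = g0 ++ v1 := by
      have s1 : v1 <:+ (invRev g ++ ([bar e0] ++ g)) := ⟨u2 ++ x1, h2.symm⟩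
      have s2 : g <:+ (invRev g ++ ([bar e0] ++ g)) := ⟨invRev g ++ [bar e0], by simp⟩
      obtain ⟨g0, h⟩ := List.suffix_of_suffix_length_le s1 s2 hl
      exact ⟨g0, h.symm⟩
    have hr2 : Rel (v2 ++ (b ++ v1)) := by
      refine S.rotr hr ?_
      simpa using rot_comm v1 (v2 ++ b)
    have hn := hlr [] v2 (x3 ++ u1) _ (by simpa [h1] using M.1.1) hr2
    have hk : N Rel (mk g0 * (mk b)⁻¹ * (mk v2)⁻¹ * (mk v1)⁻¹ * (mk g0)⁻¹) := by
      refine ((N.rel hr).inv S).tr (mk g0) ?_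
      simp only [mk_app]; group
    refine M.lt (g' := g0 ++ invRev b) (w' := x3 ++ u1 ++ v2) (M.1.1.trans ?_) (modN S hk M.1.2 ?_) ?_
    · rw [h1]; simpa using rot_comm v2 (x3 ++ u1)
    · rw [hg, h1]; simp only [mk_app, mk_inv]; group
    · rw [hg]
      simp at f1 f2 hn hb ⊢
      have : (b.length : ℝ) < v1.length := by nlinarith
      exact_mod_cast this
  · obtain ⟨b, hr, hb⟩ := hu
    obtain ⟨f1, f2⟩ := S.facts hr
    obtain ⟨g0, hg⟩ : ∃ g0, invRev g = u2 ++ g0 := by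
      have s1 : u2 <+: (invRev g ++ ([bar e0] ++ g)) := ⟨x1 ++ v1, by rw [h2]; simp⟩
      have s2 : invRev g <+: (invRev g ++ ([bar e0] ++ g)) := ⟨[bar e0] ++ g, rfl⟩
      obtain ⟨g0, h⟩ := List.prefix_of_prefix_length_le s1 s2 (by simpa using hl)
      exact ⟨g0, h.symm⟩
    have hg' : g = invRev g0 ++ invRev u2 := by
      rw [← invRev_invRev (L₁ := g), hg]; simp [invRev_append]
    have hr2 : Rel (u1 ++ (u2 ++ b)) := by simpa using hr
    have hn := hlr (v2 ++ x3) u1 [] _ (by simpa [h1] using M.1.1) hr2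
    have hk : N Rel ((mk g0)⁻¹ * mk b * mk u1 * mk u2 * mk g0) := by
      refine (N.rel hr).tr ((mk g0)⁻¹ * mk b) ?_
      simp only [mk_app]; group
    refine M.lt (g' := invRev g0 ++ b) (w' := u1 ++ (v2 ++ x3)) (M.1.1.trans ?_) (modN S hk M.1.2 ?_) ?_
    · rw [h1]; simpa using rot_comm (v2 ++ x3) u1
    · rw [hg', h1]; simp only [mk_app, mk_inv]; group
    · rw [hg']
      simp at f1 f2 hn hb ⊢
      have : (b.length : ℝ) < u2.length := by nlinarith
      exact_mod_cast this

theorem Mn.pos (S : SC lam Rel) (hlr : LR lam Rel w0) (M : Mn Rel e0 w0 g w) {x1 a x3 a' : Wd α}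
    (ha : Shell 3 lam Rel a) (ha' : Shell 3 lam Rel a')
    (h : (w ++ (invRev g ++ ([bar e0] ++ g))) ~r (x1 ++ a ++ x3 ++ a')) :
    (∃ v1 v2 u1 u2, a = v1 ++ v2 ∧ a' = u1 ++ u2 ∧ w = v2 ++ x3 ++ u1 ∧
      invRev g ++ ([bar e0] ++ g) = u2 ++ x1 ++ v1) ∨
    (∃ v1 v2 u1 u2, a = v1 ++ v2 ∧ a' = u1 ++ u2 ∧ invRev g ++ ([bar e0] ++ g) = v2 ++ x3 ++ u1 ∧
      w = u2 ++ x1 ++ v1) := by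
  obtain ⟨b, hr, hb⟩ := ha
  obtain ⟨b', hr', hb'⟩ := ha'
  rcases LL_of h with ⟨y, z, e, -⟩ | ⟨y, z, e, -⟩ | ⟨y, z, e, -⟩ | ⟨y, z, e, -⟩ | h | h
  · exact absurd hb (hlr y a z b (e ▸ M.1.1) hr)
  · exact (M.shellI S e hr hb).elim
  · exact absurd hb' (hlr y a' z b' (e ▸ M.1.1) hr')
  · exact (M.shellI S e hr' hb').elim
  · exact Or.inl h
  · exact Or.inr h

theorem Mn.false (S : SC lam Rel) (hw0 : CR w0) (hne : w0 ≠ [e0]) (hlr : LR lam Rel w0)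
    (M : Mn Rel e0 w0 g w) : False := by
  have hcr := M.cr S hw0 hne hlr
  have hN : N Rel (mk (g ++ (w ++ (invRev g ++ [bar e0])))) := by
    refine M.1.2.tr 1 ?_
    simp only [mk_app, mk_inv, mk_cons', mk_nil', mk_bar]; group
  obtain ⟨n, hn⟩ := hN
  obtain ⟨m, -, hm⟩ := exact_of hn
  have hm1 := hm.pos (hcr.red.ne_one (by simp))
  have hrot : (w ++ (invRev g ++ ([bar e0] ++ g))) ~r (g ++ (w ++ (invRev g ++ [bar e0]))) := by
    simpa using rot_comm (w ++ (invRev g ++ [bar e0])) g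
  rcases Bcyc S hcr hm hm1 with h | ⟨a, y, a', z, h, h1, h2⟩ | ⟨a, y, a', y', a'', z, h, h1, h2, h3⟩
  · exact M.relW S hlr h
  · have hr2 : (w ++ (invRev g ++ ([bar e0] ++ g))) ~r (z ++ a ++ y ++ a') := by
      refine (hrot.trans h).trans ?_
      simpa using rot_comm (a ++ y ++ a') z
    rcases M.pos S hlr (h1.weak S) (h2.weak S) hr2 with ⟨v1, v2, u1, u2, rfl, rfl, e1, e2⟩ | ⟨v1, v2, u1, u2, rfl, rfl, e1, e2⟩
    · exact M.two S hlr h1 h2 e1 e2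
    · exact M.two S hlr h2 h1 e2 e1
  · have hr2 : (w ++ (invRev g ++ ([bar e0] ++ g))) ~r ((y' ++ a'' ++ z) ++ a ++ y ++ a') := by
      refine (hrot.trans h).trans ?_
      simpa using rot_comm (a ++ y ++ a') (y' ++ a'' ++ z)
    obtain ⟨b, hr, hb⟩ := h3
    rcases M.pos S hlr h1 h2 hr2 with ⟨v1, v2, u1, u2, rfl, rfl, e1, e2⟩ | ⟨v1, v2, u1, u2, rfl, rfl, e1, e2⟩
    · exact M.shellI S (x := u2 ++ y') (a := a'') (y := z ++ v1) (by rw [e2]; simp) hr hb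
    · refine hlr (u2 ++ y') a'' (z ++ v1) b ?_ hr hb
      have := M.1.1
      rw [e2] at this
      simpa using this

end

theorem final (S : SC lam Rel) {e0 : α × Bool} {w0 : Wd α} (hw0 : CR w0) (hne : w0 ≠ [e0])
    (hlr : LR lam Rel w0) (g : FreeGroup α) (hg : N Rel (g * mk w0 * g⁻¹ * (gen e0)⁻¹)) : False := by
  obtain ⟨⟨g1, w1⟩, h1, h2⟩ := lexmin (fun p : Wd α × Wd α => Good Rel e0 w0 p.1 p.2)
    (fun p => p.1.length) (fun _ => 0) ⟨(g.toWord, w0), List.IsRotated.refl _, by simpa [mk_toWord] using hg⟩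
  exact Mn.false S hw0 hne hlr (g := g1) (w := w1) ⟨h1, fun g' w' h => (h2 (g', w') h).1⟩

end SCG

set_option linter.unusedSectionVars false
set_option linter.unusedSimpArgs false
set_option linter.unusedVariables false

namespace SCG
open FreeGroup
variable {α : Type} [DecidableEq α]

/-- words of relators -/
def RelOf (R : Set (FreeGroup α)) (L : Wd α) : Prop := Red L ∧ mk L ∈ R

theorem SC_of {lam : ℝ} {R : Set (FreeGroup α)} (h0 : 0 < lam) (h1 : lam ≤ 1 / 100) (hR : CPrime lam R)
    (hlen : ∀ r ∈ R, 2 / lam + 1 ≤ (r.toWord.length : ℝ)) : SC lam (RelOf R) := by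
  obtain ⟨⟨hc, hrot, hinv⟩, hp⟩ := hR
  have hcr : ∀ {L : Wd α}, RelOf R L → CR L := by
    intro L h
    apply CR_of h.1
    rintro e M rfl
    have h2 := hc _ h.2 e (bar e)
    rw [h.1.toWord] at h2
    refine h2 (by simp) (by rw [List.getLast?_append]; simp) ?_
    exact (bar_bar e).symm
  refine ⟨h0, h1, hcr, ?_, ?_, ?_, ?_⟩
  · intro a b h
    refine ⟨(hcr h).redrot (rot_comm a b), ?_⟩
    have := hrot _ h.2 a.length
    rwa [h.1.toWord, List.rotate_append_length_eq] at this
  · intro L h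
    refine ⟨h.1.inv, ?_⟩
    rw [mk_inv]
    exact hinv _ h.2
  · intro b x y hx hy hne
    have := hp b ⟨mk (b ++ x), hx.2, mk (b ++ y), hy.2, ?_, ?_, ?_⟩ (mk (b ++ x)) hx.2 ?_
    · rwa [hx.1.toWord] at this
    · intro he
      exact hne (List.append_cancel_left (hx.1.inj hy.1 he))
    · rw [hx.1.toWord]; exact ⟨x, rfl⟩
    · rw [hy.1.toWord]; exact ⟨y, rfl⟩
    · rw [hx.1.toWord]; exact ⟨[], x, by simp⟩
  · intro L h
    have := hlen _ h.2
    rwa [h.1.toWord] at this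

theorem N_of {lam : ℝ} {R : Set (FreeGroup α)} (S : SC lam (RelOf R)) {x : FreeGroup α}
    (hx : x ∈ Subgroup.normalClosure R) : N (RelOf R) x := by
  unfold Subgroup.normalClosure at hx
  induction hx using Subgroup.closure_induction with
  | mem x hx =>
    obtain ⟨r, hr, hc⟩ := Group.mem_conjugatesOfSet_iff.1 hx
    obtain ⟨c, hc⟩ := isConj_iff.1 hc
    have h1 : RelOf R r.toWord := ⟨Red_toWord r, by rwa [mk_toWord]⟩
    refine (N.rel h1).tr c ?_
    rw [mk_toWord, hc]
  | one => exact ⟨0, Ar.one 0⟩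
  | mul x y _ _ hx hy => exact hx.mul hy
  | inv x _ hx => exact hx.inv S

theorem LR_of {lam : ℝ} {R : Set (FreeGroup α)} {w0 : Wd α} (h : CyclLambdaReduced lam R w0) :
    LR lam (RelOf R) w0 := by
  intro x a y b hr hab hb
  obtain ⟨n, hn⟩ := hr
  have := h n a ⟨x, y, hn⟩ _ hab.2 (by rw [hab.1.toWord]; exact ⟨[], b, by simp⟩)
  rw [hab.1.toWord] at this
  simp at this hb
  linarith

end SCG

theorem statement6 (k : ℕ) (hk : 0 < k) (lam : ℝ) (hlam0 : 0 < lam)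
    (hlam : lam ≤ 1 / 100)
    (R : Set (FreeGroup (Fin k))) (hR : CPrime lam R)
    (hlen : ∀ r ∈ R, 2 / lam + 1 ≤ (r.toWord.length : ℝ))
    (w : FreeGroup (Fin k)) (hw : CyclicallyReduced w)
    (hconj : IsConj (PresentedGroup.mk R w)
      (PresentedGroup.of (rels := R) (⟨0, hk⟩ : Fin k))) :
    w = FreeGroup.of (⟨0, hk⟩ : Fin k) ∨ ¬ CyclLambdaReduced lam R w.toWord := by
  by_contra hcon
  push Not at hcon
  obtain ⟨hne, hred⟩ := hcon
  have S := SCG.SC_of hlam0 hlam hR hlen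
  obtain ⟨c, hc⟩ := isConj_iff.1 hconj
  obtain ⟨g, rfl⟩ := PresentedGroup.mk_surjective R c
  have hmem : g * w * g⁻¹ * (FreeGroup.of (⟨0, hk⟩ : Fin k))⁻¹ ∈ Subgroup.normalClosure R := by
    have h1 : PresentedGroup.mk R (g * w * g⁻¹ * (FreeGroup.of (⟨0, hk⟩ : Fin k))⁻¹) = 1 := by
      rw [map_mul, map_mul, map_mul, map_inv, map_inv, hc]
      exact mul_inv_cancel _
    exact (QuotientGroup.eq_one_iff _).1 h1
  have hN := SCG.N_of S hmem
  have hcr : SCG.CR w.toWord := by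
    apply SCG.CR_of (SCG.Red_toWord w)
    intro e M h
    refine hw e (SCG.bar e) (by rw [h]; simp) (by rw [h, List.getLast?_append]; simp) ?_
    exact (SCG.bar_bar e).symm
  refine SCG.final S (e0 := ((⟨0, hk⟩ : Fin k), true)) hcr ?_ (SCG.LR_of hred) g ?_
  · intro h
    apply hne
    rw [← FreeGroup.mk_toWord (x := w), h]
    rfl
  · rw [FreeGroup.mk_toWord]
    exact hN
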